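/- arXiv:0908.1956 — 2 statements merged into one kernel-verified Lean document; each statement's English description precedes it below -/
import Mathlib

section
/- Spectrum recursion for pure cubical near-prisms: Let n ≥ 1, d ≥ 1, and let X ⊆ Q_n be a pure d-dimensional proper cubical complex that is a near-prism in direction 1. Then the multiset of nonzero eigenvalues of L^ud_{d−1}(X) equals the multiset sum of: (the multiset of nonzero eigenvalues of L^ud_{d−1}(Del_1 X)) and (the multiset {μ + 2 : μ ∈ s^tot_{d−1}(Del_1 X)}, the full spectrum of L^tot_{d−1}(Del_1 X) shifted by 2). [This single identity combines the two cases of the theorem: when X is a prism, i.e. X = P_1(Link_1 X), the complex Del_1 X = Link_1 X has no d-faces, so the first summand is empty and the second runs over the ℓ eigenvalues of L^du_{d−1}(Link_1 X), where ℓ is the number of facets of Link_1 X.] -/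
open BigOperators Matrix

namespace CubicalPaper

/-- Faces of the `n`-cube `Q_n`: tuples in `{0, 1, ✱}ⁿ`, with `2 : Fin 3` playing the
role of `✱`. -/
abbrev Face (n : ℕ) : Type := Fin n → Fin 3

/-- The direction set of a face: the coordinates equal to `✱`. -/
def dir {n : ℕ} (f : Face n) : Finset (Fin n) := Finset.univ.filter fun i => f i = 2

/-- The dimension of a face. -/
def fdim {n : ℕ} (f : Face n) : ℕ := (dir f).card

/-- The partial order on `Q_n`: `f ≤ g` iff `f i = g i` whenever `g i ≠ ✱`. -/
def cubeLE {n : ℕ} (f g : Face n) : Prop := ∀ i, g i ≠ 2 → f i = g i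

/-- A proper cubical complex: a downward-closed set of faces of `Q_n`. -/
def IsComplex {n : ℕ} (X : Finset (Face n)) : Prop :=
  ∀ g ∈ X, ∀ f, cubeLE f g → f ∈ X

/-- The incidence sign `ε(f, g)`: if `dir g = {a_1 < ⋯ < a_i}` and `f` is obtained from
`g` by changing the entry `g (a_j) = ✱` to `0` (resp. `1`), then `ε(f,g) = (-1)^j`
(resp. `(-1)^(j+1)`); in all other cases `ε(f,g) = 0`. -/
def eps {n : ℕ} (f g : Face n) : ℤ :=
  ∑ a : Fin n,
    if g a = 2 ∧ f a ≠ 2 ∧ ∀ b, b ≠ a → f b = g b then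
      (-1 : ℤ) ^ ((Finset.univ.filter fun b => g b = 2 ∧ b ≤ a).card +
        if f a = 1 then 1 else 0)
    else 0

/-- The `k`-dimensional faces of `X`. -/
def faceSet {n : ℕ} (X : Finset (Face n)) (k : ℕ) : Finset (Face n) :=
  X.filter fun f => fdim f = k

/-- The real cubical boundary matrix `∂_{k+1}` of `X`, with rows indexed by `X_k`
and columns by `X_{k+1}`, entries `ε(f, g)`. -/
def bdryM {n : ℕ} (X : Finset (Face n)) (k : ℕ) :
    Matrix {f // f ∈ faceSet X k} {g // g ∈ faceSet X (k + 1)} ℝ :=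
  Matrix.of fun f g => (eps f.1 g.1 : ℝ)

/-- The up-down Laplacian `L^ud_k = ∂_{k+1} ∂_{k+1}^T`. -/
noncomputable def Lud {n : ℕ} (X : Finset (Face n)) (k : ℕ) :
    Matrix {f // f ∈ faceSet X k} {f // f ∈ faceSet X k} ℝ :=
  bdryM X k * (bdryM X k)ᵀ

/-- The down-up Laplacian `L^du_k = ∂_k^T ∂_k` (with `∂_0 = 0`). -/
noncomputable def Ldu {n : ℕ} (X : Finset (Face n)) :
    (k : ℕ) → Matrix {f // f ∈ faceSet X k} {f // f ∈ faceSet X k} ℝ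
  | 0 => 0
  | (j + 1) => (bdryM X j)ᵀ * bdryM X j

/-- The total Laplacian `L^tot_k = L^ud_k + L^du_k`. -/
noncomputable def Ltot {n : ℕ} (X : Finset (Face n)) (k : ℕ) :
    Matrix {f // f ∈ faceSet X k} {f // f ∈ faceSet X k} ℝ :=
  Lud X k + Ldu X k

/-- The spectrum `s^tot_k(X)` of `L^tot_k`: the multiset of roots of its characteristic
polynomial (all of which are real, `L^tot_k` being real symmetric). -/
noncomputable def stot {n : ℕ} (X : Finset (Face n)) (k : ℕ) : Multiset ℝ :=
  (Ltot X k).charpoly.roots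

/-- The spectrum `s^ud_k(X)` of `L^ud_k`. -/
noncomputable def sud {n : ℕ} (X : Finset (Face n)) (k : ℕ) : Multiset ℝ :=
  (Lud X k).charpoly.roots

/-- The deletion of `X ⊆ Q_{n+1}` in direction `1` (the first coordinate). -/
def del1 {n : ℕ} (X : Finset (Face (n + 1))) : Finset (Face n) :=
  (X.filter fun f => f 0 ≠ 2).image Fin.tail

/-- The link of `X ⊆ Q_{n+1}` in direction `1` (the first coordinate). -/
def link1 {n : ℕ} (X : Finset (Face (n + 1))) : Finset (Face n) :=
  (X.filter fun f => f 0 = 2).image Fin.tail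

/-- `X` is pure `d`-dimensional: every maximal face has dimension `d`. -/
def IsPure {n : ℕ} (X : Finset (Face n)) (d : ℕ) : Prop :=
  ∀ f ∈ X, (∀ g ∈ X, cubeLE f g → f = g) → fdim f = d

/-- `X ⊆ Q_{n+1}` is a near-prism in direction `1`: every proper subface of a face of
`Del₁ X` lies in `Link₁ X`, and both `0¹(Del₁ X)` and `1¹(Del₁ X)` are contained
in `X`. -/
def IsNearPrism1 {n : ℕ} (X : Finset (Face (n + 1))) : Prop :=
  (∀ g ∈ del1 X, ∀ f, cubeLE f g → f ≠ g → f ∈ link1 X) ∧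
    (∀ h ∈ del1 X, Fin.cons 0 h ∈ X ∧ Fin.cons 1 h ∈ X)

section LinearAlgebra

variable {m p r : Type*} [Fintype m] [Fintype p] [Fintype r]
  [DecidableEq m] [DecidableEq r]

/-- The boundary matrix of a near-prism in block form, where `B` and `C` are consecutive
boundary matrices of the deletion. -/
def prismBoundary (B : Matrix m p ℝ) (C : Matrix r m ℝ) :
    Matrix (m ⊕ m ⊕ r) (p ⊕ p ⊕ m) ℝ :=
  fromBlocks B (fromCols 0 (-1)) 0 (fromBlocks B 1 0 (-C))

theorem charpoly_prismBoundary_mul_transpose (B : Matrix m p ℝ) (C : Matrix r m ℝ)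
    (hCB : C * B = 0) :
    (prismBoundary B C * (prismBoundary B C)ᵀ).charpoly =
      (B * Bᵀ).charpoly * ((B * Bᵀ + Cᵀ * C + scalar m 2).charpoly *
        Polynomial.X ^ Fintype.card r) := by
  set T : Matrix m m ℝ := B * Bᵀ + Cᵀ * C + scalar m 2 with hT
  let P : Matrix (m ⊕ m ⊕ r) (m ⊕ m ⊕ r) ℝ :=
    fromBlocks 1 (fromCols 1 0) (fromRows 1 0) (fromBlocks (-1) 0 C 1)
  let Q : Matrix (m ⊕ m ⊕ r) (m ⊕ m ⊕ r) ℝ :=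
    fromBlocks ((1 / 2 : ℝ) • 1) (fromCols ((1 / 2 : ℝ) • 1) 0)
      (fromRows ((1 / 2 : ℝ) • 1) ((-1 / 2 : ℝ) • C))
      (fromBlocks ((-1 / 2 : ℝ) • 1) 0 ((1 / 2 : ℝ) • C) 1)
  let D : Matrix (m ⊕ m ⊕ r) (m ⊕ m ⊕ r) ℝ :=
    fromBlocks (B * Bᵀ) 0 0 (fromBlocks T Cᵀ 0 0)
  have hCBB : C * (B * Bᵀ) = 0 := by rw [← Matrix.mul_assoc, hCB, Matrix.zero_mul]
  have hPQ : P * Q = 1 := by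
    ext (i | i | i) (j | j | j) <;>
      simp [P, Q, fromBlocks_multiply, fromCols_mul_fromRows, fromCols_mul_fromBlocks, 
        fromBlocks_mul_fromRows, mul_fromCols, Matrix.one_apply] <;>
      grind
  have hSP : prismBoundary B C * (prismBoundary B C)ᵀ * P = P * D := by
    ext (i | i | i) (j | j | j) <;>
      simp [prismBoundary, P, D, T, fromBlocks_transpose, transpose_fromCols, fromBlocks_multiply,
        fromCols_mul_fromRows, fromCols_mul_fromBlocks, fromBlocks_mul_fromRows, fromRows_mul, mul_fromCols,
        Matrix.mul_add, hCBB, ← Matrix.mul_assoc, Matrix.one_apply, Matrix.diagonal_apply] <;>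
      grind
  have hQP : Q * P = 1 := mul_eq_one_comm.1 hPQ
  have hconj : prismBoundary B C * (prismBoundary B C)ᵀ = P * D * Q := by
    rw [← hSP, Matrix.mul_assoc _ P, hPQ, Matrix.mul_one]
  rw [hconj, charpoly_mul_comm, ← Matrix.mul_assoc, hQP, Matrix.one_mul,
    charpoly_fromBlocks_zero₁₂, charpoly_fromBlocks_zero₂₁, charpoly_zero]

theorem filter_roots_charpoly_prismBoundary (B : Matrix m p ℝ) (C : Matrix r m ℝ)
    (hCB : C * B = 0) :
    (prismBoundary B C * (prismBoundary B C)ᵀ).charpoly.roots.filter (fun x => x ≠ 0) =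
      (B * Bᵀ).charpoly.roots.filter (fun x => x ≠ 0) +
        (B * Bᵀ + Cᵀ * C).charpoly.roots.map (fun x => x + 2) := by
  set M : Matrix m m ℝ := B * Bᵀ + Cᵀ * C with hM
  have hshift : (M + scalar m 2).charpoly.roots = M.charpoly.roots.map (fun x => x + 2) := by
    have h := charpoly_sub_scalar (M + scalar m 2) 2
    rw [add_sub_cancel_right] at h
    rw [h]
    have h' := (M + scalar m 2).charpoly.map_roots_comp_C_mul_X_add_C 1 2 isUnit_one
    simpa only [map_one, one_mul] using h'.symm
  have hpsd : M.PosSemidef := by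
    simpa [hM] using (posSemidef_self_mul_conjTranspose B).add (posSemidef_conjTranspose_mul_self C)
  have hpos : ∀ x ∈ M.charpoly.roots.map (fun x => x + 2), x ≠ 0 := by
    rw [hpsd.1.roots_charpoly_eq_eigenvalues]
    simp only [Multiset.mem_map]
    rintro _ ⟨_, ⟨i, -, rfl⟩, rfl⟩
    have := hpsd.eigenvalues_nonneg i
    simp
    linarith
  have hzero : (Fintype.card r • {(0 : ℝ)} : Multiset ℝ).filter (fun x => x ≠ 0) = 0 := by
    refine Multiset.filter_eq_nil.2 fun x hx => ?_
    simpa using Multiset.mem_of_mem_nsmul hx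
  rw [charpoly_prismBoundary_mul_transpose B C hCB, Polynomial.roots_mul, Polynomial.roots_mul,
    Polynomial.roots_X_pow, hshift, Multiset.filter_add, Multiset.filter_add,
    Multiset.filter_eq_self.2 hpos, hzero, add_zero]
  · exact mul_ne_zero (charpoly_monic _).ne_zero (pow_ne_zero _ Polynomial.X_ne_zero)
  · exact mul_ne_zero (charpoly_monic _).ne_zero
      (mul_ne_zero (charpoly_monic _).ne_zero (pow_ne_zero _ Polynomial.X_ne_zero))

end LinearAlgebra

theorem eps_cons {n : ℕ} (a b : Fin 3) (f g : Face n) :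
    eps (Fin.cons a f : Face (n + 1)) (Fin.cons b g : Face (n + 1)) =
      if a = b then (if b = 2 then - eps f g else eps f g)
      else if b = 2 ∧ f = g then (if a = 1 then 1 else -1) else 0 := by
  have hfg : (∀ x : Fin n, f x = g x) ↔ f = g := funext_iff.symm
  have h0 : ∀ x : Fin n, (0 : Fin (n + 1)) ≠ x.succ := fun x => (Fin.succ_ne_zero x).symm
  simp only [eps, Fin.sum_univ_succ, Fin.card_filter_univ_succ, Fin.forall_fin_succ, Fin.cons_zero,
    Fin.cons_succ, Fin.succ_le_succ_iff, Fin.zero_le, Fin.succ_inj, ne_eq, Fin.succ_ne_zero,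
    not_true, not_false_iff, forall_const, h0, hfg, true_and, and_true, Fin.le_zero_iff, and_false,
    IsEmpty.forall_iff]
  by_cases hab : a = b
  · subst hab
    by_cases ha : a = 2
    · subst ha
      simp [← Finset.sum_neg_distrib, apply_ite, pow_add]
    · simp [ha]
  · by_cases hb : b = 2
    · subst hb
      by_cases hf : f = g <;> simp [hab, hf]
      fin_cases a <;> simp_all
    · simp [hab, hb]

theorem eps_ne_zero {n : ℕ} {f g : Face n} (h : eps f g ≠ 0) :
    cubeLE f g ∧ fdim f + 1 = fdim g := by
  obtain ⟨a, -, ha⟩ := Finset.exists_ne_zero_of_sum_ne_zero h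
  have ha' : g a = 2 ∧ f a ≠ 2 ∧ ∀ b, b ≠ a → f b = g b := by
    by_contra hc
    exact ha (if_neg hc)
  obtain ⟨h1, h2, h3⟩ := ha'
  refine ⟨fun i hi => h3 i (by rintro rfl; exact hi h1), ?_⟩
  have : dir g = insert a (dir f) := by
    ext i
    by_cases hi : i = a
    · simp [dir, hi, h1]
    · simp [dir, hi, h3 i hi]
  rw [fdim, fdim, this, Finset.card_insert_of_notMem (by simp [dir, h2])]

theorem sum_face_succ {n : ℕ} (F : Face (n + 1) → ℤ) :
    ∑ f, F f = ∑ k : Fin 3, ∑ f : Face n, F (Fin.cons k f) := by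
  rw [← (Fin.consEquiv (fun _ : Fin (n + 1) => Fin 3)).sum_comp, Fintype.sum_prod_type]
  rfl

theorem sum_eps_mul_eps {n : ℕ} (h g : Face n) : ∑ f, eps h f * eps f g = 0 := by
  induction n with
  | zero => simp [eps]
  | succ n ih =>
    induction h using Fin.consCases with | cons c h =>
    induction g using Fin.consCases with | cons b g =>
    have := ih h g
    simp only [sum_face_succ, eps_cons, Fin.sum_univ_three]
    fin_cases c <;> fin_cases b <;>
      simp [mul_ite, ite_mul, this]

theorem fdim_cons {n : ℕ} (k : Fin 3) (f : Face n) :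
    fdim (Fin.cons k f : Face (n + 1)) = fdim f + if k = 2 then 1 else 0 := by
  simp only [fdim, dir, Fin.card_filter_univ_succ, Fin.cons_zero, Fin.cons_succ]
  split_ifs <;> rfl

theorem cubeLE_cons {n : ℕ} {a b : Fin 3} {f g : Face n} :
    cubeLE (Fin.cons a f : Face (n + 1)) (Fin.cons b g : Face (n + 1)) ↔
      (b ≠ 2 → a = b) ∧ cubeLE f g := by
  simp [cubeLE, Fin.forall_fin_succ]

theorem mem_link1 {n : ℕ} {X : Finset (Face (n + 1))} {f : Face n} :
    f ∈ link1 X ↔ (Fin.cons 2 f : Face (n + 1)) ∈ X := by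
  simp only [link1, Finset.mem_image, Finset.mem_filter]
  constructor
  · rintro ⟨g, ⟨hg, h2⟩, rfl⟩
    rwa [← h2, Fin.cons_self_tail]
  · exact fun h => ⟨_, ⟨h, rfl⟩, Fin.tail_cons _ _⟩

theorem mem_del1_of_cons_mem {n : ℕ} {X : Finset (Face (n + 1))} {k : Fin 3} {f : Face n}
    (hk : k ≠ 2) (h : (Fin.cons k f : Face (n + 1)) ∈ X) : f ∈ del1 X := by
  simp only [del1, Finset.mem_image, Finset.mem_filter]
  exact ⟨_, ⟨h, hk⟩, Fin.tail_cons _ _⟩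

theorem IsNearPrism1.cons_mem_iff {n : ℕ} {X : Finset (Face (n + 1))} (hnp : IsNearPrism1 X)
    {k : Fin 3} (hk : k ≠ 2) {f : Face n} :
    (Fin.cons k f : Face (n + 1)) ∈ X ↔ f ∈ del1 X := by
  refine ⟨mem_del1_of_cons_mem hk, fun h => ?_⟩
  have := hnp.2 f h
  fin_cases k
  · exact this.1
  · exact this.2
  · exact absurd rfl hk

theorem IsComplex.mem_del1_of_mem_link1 {n : ℕ} {X : Finset (Face (n + 1))} (hX : IsComplex X)
    {f : Face n} (hf : f ∈ link1 X) : f ∈ del1 X :=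
  mem_del1_of_cons_mem (k := 0) (by decide)
    (hX _ (mem_link1.1 hf) _ (cubeLE_cons.2 ⟨fun h => absurd rfl h, fun _ _ => rfl⟩))

theorem IsComplex.del1 {n : ℕ} {X : Finset (Face (n + 1))} (hX : IsComplex X)
    (hnp : IsNearPrism1 X) : IsComplex (del1 X) := fun _ hg _ hfg =>
  mem_del1_of_cons_mem (k := 0) (by decide)
    (hX _ (hnp.2 _ hg).1 _ (cubeLE_cons.2 ⟨fun _ => rfl, hfg⟩))

theorem IsNearPrism1.mem_link1_of_fdim_ne {n d : ℕ} {X : Finset (Face (n + 1))}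
    (hX : IsComplex X) (hpure : IsPure X d) (hnp : IsNearPrism1 X) {f : Face n}
    (hf : f ∈ CubicalPaper.del1 X) (hd : fdim f ≠ d) : f ∈ link1 X := by
  by_contra hlink
  have := hpure _ (hnp.2 f hf).1 fun g hg hle => ?_
  · simp [fdim_cons] at this
    exact hd this
  · induction g using Fin.consCases with | cons k g =>
    rw [cubeLE_cons] at hle
    by_cases hk : k = 2
    · subst hk
      exact absurd (mem_link1.2 (hX _ hg _ (cubeLE_cons.2 ⟨fun _ => rfl, hle.2⟩))) hlink
    · by_cases hfg : f = g
      · rw [hfg, hle.1 hk]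
      · exact absurd (hnp.1 g (mem_del1_of_cons_mem hk hg) f hle.2 hfg) hlink

/-- Parametrization of the faces of a set whose faces over `0` and `1` are those of
`D`, and whose faces in the first direction are those of `S`. -/
noncomputable def prismEquiv {n : ℕ} {Y : Finset (Face (n + 1))} {D S : Finset (Face n)}
    (hY : ∀ k f, (Fin.cons k f : Face (n + 1)) ∈ Y ↔ if k = 2 then f ∈ S else f ∈ D) :
    {f // f ∈ D} ⊕ {f // f ∈ D} ⊕ {f // f ∈ S} ≃ {f // f ∈ Y} :=
  Equiv.ofBijective
    (Sum.elim (fun f => ⟨Fin.cons 0 f.1, (hY _ _).2 f.2⟩)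
      (Sum.elim (fun f => ⟨Fin.cons 1 f.1, (hY _ _).2 f.2⟩)
        (fun f => ⟨Fin.cons 2 f.1, (hY _ _).2 f.2⟩))) <| by
    constructor
    · rintro (⟨f, hf⟩ | ⟨f, hf⟩ | ⟨f, hf⟩) (⟨g, hg⟩ | ⟨g, hg⟩ | ⟨g, hg⟩) h <;>
        simp [Fin.cons_inj] at h <;> simp [h]
    · rintro ⟨f, hf⟩
      induction f using Fin.consCases with | cons k f =>
      have := (hY _ _).1 hf
      fin_cases k
      · exact ⟨.inl ⟨f, this⟩, rfl⟩
      · exact ⟨.inr (.inl ⟨f, this⟩), rfl⟩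
      · exact ⟨.inr (.inr ⟨f, this⟩), rfl⟩

@[simp]
theorem coe_prismEquiv_inl {n : ℕ} {Y : Finset (Face (n + 1))} {D S : Finset (Face n)}
    (hY : ∀ k f, (Fin.cons k f : Face (n + 1)) ∈ Y ↔ if k = 2 then f ∈ S else f ∈ D)
    (f : {f // f ∈ D}) : (prismEquiv hY (.inl f) : Face (n + 1)) = Fin.cons 0 f.1 :=
  rfl

@[simp]
theorem coe_prismEquiv_inr_inl {n : ℕ} {Y : Finset (Face (n + 1))} {D S : Finset (Face n)}
    (hY : ∀ k f, (Fin.cons k f : Face (n + 1)) ∈ Y ↔ if k = 2 then f ∈ S else f ∈ D)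
    (f : {f // f ∈ D}) : (prismEquiv hY (.inr (.inl f)) : Face (n + 1)) = Fin.cons 1 f.1 :=
  rfl

@[simp]
theorem coe_prismEquiv_inr_inr {n : ℕ} {Y : Finset (Face (n + 1))} {D S : Finset (Face n)}
    (hY : ∀ k f, (Fin.cons k f : Face (n + 1)) ∈ Y ↔ if k = 2 then f ∈ S else f ∈ D)
    (f : {f // f ∈ S}) : (prismEquiv hY (.inr (.inr f)) : Face (n + 1)) = Fin.cons 2 f.1 :=
  rfl

/-- The faces of dimension `e - 1`, of which there are none when `e = 0`. -/
def ridges {n : ℕ} (D : Finset (Face n)) (e : ℕ) : Finset (Face n) :=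
  D.filter fun f => fdim f + 1 = e

/-- The boundary matrix `∂_e`, with rows indexed by the faces of dimension `e - 1`. -/
def ridgeM {n : ℕ} (D : Finset (Face n)) (e : ℕ) :
    Matrix {f // f ∈ ridges D e} {f // f ∈ faceSet D e} ℝ :=
  Matrix.of fun f g => (eps f.1 g.1 : ℝ)

theorem Ldu_eq_ridgeM {n : ℕ} (D : Finset (Face n)) (e : ℕ) :
    Ldu D e = (ridgeM D e)ᵀ * ridgeM D e := by
  ext g g'
  simp only [Matrix.mul_apply, Matrix.transpose_apply, ridgeM, Matrix.of_apply]
  rw [Finset.sum_coe_sort (ridges D e) fun f => (eps f g.1 : ℝ) * (eps f g'.1 : ℝ)]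
  cases e with
  | zero => simp [Ldu, ridges]
  | succ j =>
    simp only [Ldu, bdryM, Matrix.mul_apply, Matrix.transpose_apply, Matrix.of_apply]
    rw [Finset.sum_coe_sort (faceSet D j) fun f => (eps f g.1 : ℝ) * (eps f g'.1 : ℝ)]
    simp [ridges, faceSet]

theorem ridgeM_mul_bdryM {n : ℕ} {D : Finset (Face n)} (hD : IsComplex D) (e : ℕ) :
    ridgeM D e * bdryM D e = 0 := by
  ext h g
  simp only [Matrix.mul_apply, ridgeM, bdryM, Matrix.of_apply, Matrix.zero_apply]
  rw [Finset.sum_coe_sort (faceSet D e) fun f => (eps h.1 f : ℝ) * (eps f g.1 : ℝ),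
    Finset.sum_subset (Finset.subset_univ _)]
  · exact_mod_cast sum_eps_mul_eps h.1 g.1
  · intro f _ hf
    by_contra hne
    obtain ⟨hle, hdim⟩ := eps_ne_zero (f := f) (g := g.1)
      fun h0 => hne (by rw [h0, Int.cast_zero, mul_zero])
    have hg := Finset.mem_filter.1 g.2
    exact hf (Finset.mem_filter.2 ⟨hD _ hg.1 _ hle, by omega⟩)

theorem bdryM_submatrix_prismEquiv {n e : ℕ} {X : Finset (Face (n + 1))} {D : Finset (Face n)}
    (hrow : ∀ k f, (Fin.cons k f : Face (n + 1)) ∈ faceSet X e ↔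
      if k = 2 then f ∈ ridges D e else f ∈ faceSet D e)
    (hcol : ∀ k f, (Fin.cons k f : Face (n + 1)) ∈ faceSet X (e + 1) ↔
      if k = 2 then f ∈ faceSet D e else f ∈ faceSet D (e + 1)) :
    (bdryM X e).submatrix (prismEquiv hrow) (prismEquiv hcol) =
      prismBoundary (bdryM D e) (ridgeM D e) := by
  ext (i | i | i) (j | j | j) <;>
    simp [prismBoundary, bdryM, ridgeM, eps_cons, Matrix.one_apply, apply_ite]

/-- **Spectrum recursion for pure cubical near-prisms** (Duval–Klivans–Martin,
Thm. 5.5).  Let `X ⊆ Q_{n+1}` be a pure `d`-dimensional proper cubical complex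
(`d = e + 1 ≥ 1`) which is a near-prism in direction `1`.  Then the multiset of nonzero
eigenvalues of `L^ud_{d-1}(X)` is the multiset sum of the nonzero eigenvalues of
`L^ud_{d-1}(Del₁ X)` and the full spectrum of `L^tot_{d-1}(Del₁ X)` shifted by `2`. -/
theorem near_prism_spectrum_recursion {n : ℕ} (e : ℕ) (X : Finset (Face (n + 1)))
    (hX : IsComplex X) (hpure : IsPure X (e + 1)) (hnp : IsNearPrism1 X) :
    (sud X e).filter (fun lam => lam ≠ 0) =
      (sud (del1 X) e).filter (fun lam => lam ≠ 0) +
        (stot (del1 X) e).map (fun mu => mu + 2) := by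
  have hlink : ∀ f : Face n, fdim f ≠ e + 1 →
      ((Fin.cons 2 f : Face (n + 1)) ∈ X ↔ f ∈ del1 X) := fun f hf =>
    mem_link1.symm.trans
      ⟨hX.mem_del1_of_mem_link1, fun h => hnp.mem_link1_of_fdim_ne hX hpure h hf⟩
  have hrow : ∀ k f, (Fin.cons k f : Face (n + 1)) ∈ faceSet X e ↔
      if k = 2 then f ∈ ridges (del1 X) e else f ∈ faceSet (del1 X) e := by
    intro k f
    by_cases hk : k = 2
    · subst hk
      simp only [faceSet, ridges, Finset.mem_filter, fdim_cons, if_true]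
      exact and_congr_left fun h => hlink f (by omega)
    · simp [faceSet, fdim_cons, hk, hnp.cons_mem_iff hk]
  have hcol : ∀ k f, (Fin.cons k f : Face (n + 1)) ∈ faceSet X (e + 1) ↔
      if k = 2 then f ∈ faceSet (del1 X) e else f ∈ faceSet (del1 X) (e + 1) := by
    intro k f
    by_cases hk : k = 2
    · subst hk
      simp only [faceSet, Finset.mem_filter, fdim_cons, if_true, Nat.add_right_cancel_iff]
      exact and_congr_left fun h => hlink f (by omega)
    · simp [faceSet, fdim_cons, hk, hnp.cons_mem_iff hk]
  have hLud : (Lud X e).charpoly = (prismBoundary (bdryM (del1 X) e) (ridgeM (del1 X) e) *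
      (prismBoundary (bdryM (del1 X) e) (ridgeM (del1 X) e))ᵀ).charpoly := by
    rw [← bdryM_submatrix_prismEquiv hrow hcol, transpose_submatrix, submatrix_mul_equiv,
      ← charpoly_reindex (prismEquiv hrow).symm]
    rfl
  rw [sud, hLud, filter_roots_charpoly_prismBoundary _ _ (ridgeM_mul_bdryM (hX.del1 hnp) e), sud,
    stot, Ltot, Ldu_eq_ridgeM]
  rfl

end CubicalPaper
end

section
/- Adin's theorem (spanning tree enumeration for complete colorful complexes): Let n ≥ 2, let a_1, …, a_n be positive integers, and let X be the complete colorful complex with color classes of sizes a_1, …, a_n. For J ⊆ {1,…,n} set B(J) = (Σ_{i ∈ {1,…,n}∖J} a_i)^{∏_{j∈J}(a_j − 1)}. Then for every 0 ≤ k ≤ n−2, the torsion-weighted spanning tree count satisfies τ_k(X) = ∏_{j=0}^{k} ∏_{J ⊆ {1,…,n}, |J| = j} B(J)^{binom(n−j−2, k−j)}. -/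
open BigOperators Matrix

namespace ColorfulPaper

variable {n : ℕ} {V : Type*} [Fintype V] [LinearOrder V]

/-- A colorful subset: at most one vertex from each color class. -/
def Colorful (col : V → Fin n) (σ : Finset V) : Prop :=
  ∀ v ∈ σ, ∀ w ∈ σ, col v = col w → v = w

/-- The faces of the complete colorful complex having cardinality `k`
(i.e. dimension `k - 1`); the empty face has cardinality `0`. -/
abbrev ColFace (col : V → Fin n) (k : ℕ) : Type _ :=
  {σ : Finset V // Colorful col σ ∧ σ.card = k}

instance (col : V → Fin n) (σ : Finset V) : Decidable (Colorful col σ) := by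
  unfold Colorful; infer_instance

/-- The simplicial boundary matrix from cardinality-`(k+1)` faces to cardinality-`k`
faces (i.e. `∂_k` in dimension indexing): the `(σ ∖ {v}, σ)` entry is `(-1)^r` where `v`
is the `r`-th smallest vertex of `σ`, counting from `0`.  (For `k = 0` this is the
augmentation to the empty face.) -/
def bdCol (col : V → Fin n) (k : ℕ) :
    Matrix (ColFace col k) (ColFace col (k + 1)) ℤ :=
  Matrix.of fun τ σ =>
    if τ.1 ⊆ σ.1 then
      ∑ v ∈ σ.1 \ τ.1, (-1 : ℤ) ^ (σ.1.filter (fun w => w < v)).card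
    else 0

/-- Reduced cycles: `ZcC col c` is the kernel of the boundary map leaving the chain
group spanned by the cardinality-`c` faces (the whole group for `c = 0`, the empty face
having zero boundary). -/
def ZcC (col : V → Fin n) : (c : ℕ) → Submodule ℤ (ColFace col c → ℤ)
  | 0 => ⊤
  | (j + 1) => LinearMap.ker (Matrix.toLin' (bdCol col j))

/-- Rational reduced cycles. -/
def ZcCQ (col : V → Fin n) : (c : ℕ) → Submodule ℚ (ColFace col c → ℚ)
  | 0 => ⊤
  | (j + 1) => LinearMap.ker (Matrix.toLin' ((bdCol col j).map (Int.cast : ℤ → ℚ)))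

/-- For a set `T` of `k`-dimensional faces (cardinality `k + 1`), the homology
`H_{k-1}(X_T)` of the subcomplex `X_T`: `ker ∂_{k-1}` modulo the span of the columns of
`∂_k` indexed by `T`. -/
abbrev HsubCol (col : V → Fin n) (k : ℕ) (T : Finset (ColFace col (k + 1))) : Type _ :=
  ZcC col k ⧸
    (Submodule.span ℤ ((fun t => (bdCol col k)ᵀ t) ''
      (T : Set (ColFace col (k + 1))))).comap (ZcC col k).subtype

/-- `T` is a cellular spanning `k`-tree of the complete colorful complex. -/
def IsTreeCol (col : V → Fin n) (k : ℕ) (T : Finset (ColFace col (k + 1))) : Prop :=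
  LinearIndependent ℤ (fun t : {σ // σ ∈ T} => (bdCol col k)ᵀ (t : ColFace col (k + 1)))
    ∧ Nat.card (HsubCol col k T) ≠ 0
    ∧ T.card = Module.finrank ℚ (ZcCQ col k)

open Classical in
/-- The torsion-weighted count `τ_k(X)` of cellular spanning `k`-trees of the complete
colorful complex. -/
noncomputable def tauCol (col : V → Fin n) (k : ℕ) : ℕ :=
  ∑ T : Finset (ColFace col (k + 1)),
    if IsTreeCol col k T then (Nat.card (HsubCol col k T)) ^ 2 else 0

/-- The Cauchy–Binet formula for a Gram determinant. -/
theorem det_mul_transpose_eq_sum {R m κ : Type*} [CommRing R] [Fintype m] [DecidableEq m]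
    [Fintype κ] [DecidableEq κ] (A : Matrix m κ R) (F : Finset κ → R)
    (hF : ∀ f : m → κ, Function.Injective f →
      F (Finset.univ.image f) = (A.submatrix id f).det ^ 2) :
    (A * Aᵀ).det = ∑ T : Finset κ, if T.card = Fintype.card m then F T else 0 := by
  have expand : (A * Aᵀ).det =
      ∑ f : m → κ, (∏ i, A i (f i)) * (A.submatrix id f).det := by
    have hrow : (A * Aᵀ) = fun i => ∑ t, A i t • Aᵀ t := by
      ext i j
      simp [Matrix.mul_apply]
    rw [hrow]
    refine ((detRowAlternating : (m → R) [⋀^m]→ₗ[R] R).toMultilinearMap.map_sum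
      (fun i t => A i t • Aᵀ t)).trans ?_
    refine Finset.sum_congr rfl fun f _ => ?_
    refine (MultilinearMap.map_smul_univ _ (fun i => A i (f i)) (fun i => Aᵀ (f i))).trans ?_
    rw [smul_eq_mul, ← det_transpose (A.submatrix id f)]
    rfl
  have hinj : (A * Aᵀ).det = ∑ f : m → κ, if Function.Injective f then
      (∏ i, A i (f i)) * (A.submatrix id f).det else 0 := by
    rw [expand]
    refine Finset.sum_congr rfl fun f _ => ?_
    split_ifs with hf
    · rfl
    · obtain ⟨i, j, hij, hne⟩ := Function.not_injective_iff.1 hf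
      rw [det_zero_of_column_eq hne (fun k => by simp [hij]), mul_zero]
  rw [hinj, ← Finset.sum_fiberwise (s := Finset.univ) (g := fun f : m → κ => Finset.univ.image f)]
  refine Finset.sum_congr rfl fun T _ => ?_
  split_ifs with hT
  · have e : m ≃ T := Fintype.equivOfCardEq (by simp [hT])
    set f₀ : m → κ := fun i => (e i : κ) with hf₀
    have hf₀inj : Function.Injective f₀ := Subtype.val_injective.comp e.injective
    have himg : Finset.univ.image f₀ = T := by
      apply Finset.eq_of_subset_of_card_le
      · intro x hx
        obtain ⟨i, _, rfl⟩ := Finset.mem_image.1 hx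
        exact (e i).2
      · rw [Finset.card_image_of_injective _ hf₀inj, hT, Finset.card_univ]
    rw [← himg, hF f₀ hf₀inj, himg, sq]
    nth_rewrite 1 [det_apply']
    rw [Finset.sum_mul]
    rw [← Finset.sum_filter, Finset.filter_filter]
    symm
    refine Finset.sum_bij (fun (σ : Equiv.Perm m) _ => f₀ ∘ σ.symm) ?_ ?_ ?_ ?_
    · intro σ _
      simp only [Finset.mem_filter, Finset.mem_univ, true_and]
      refine ⟨?_, hf₀inj.comp σ.symm.injective⟩
      rw [← himg]
      ext x
      simp only [Finset.mem_image, Finset.mem_univ, true_and, Function.comp]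
      exact ⟨fun ⟨a, h⟩ => ⟨_, h⟩, fun ⟨a, h⟩ => ⟨σ a, by simpa using h⟩⟩
    · intro σ _ τ _ h
      have := hf₀inj.comp_left h
      exact Equiv.symm_bijective.injective (Equiv.ext (congrFun this))
    · intro f hf
      simp only [Finset.mem_filter, Finset.mem_univ, true_and] at hf
      obtain ⟨him, hfi⟩ := hf
      have hmem : ∀ i, f i ∈ T := fun i => him ▸ Finset.mem_image_of_mem f (Finset.mem_univ i)
      have hb : Function.Bijective fun i => e.symm ⟨f i, hmem i⟩ := by
        rw [← Finite.injective_iff_bijective]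
        intro i j h
        simpa [hfi.eq_iff] using h
      refine ⟨(Equiv.ofBijective _ hb).symm, Finset.mem_univ _, ?_⟩
      ext i
      simp [hf₀]
    · intro σ _
      have h1 : (A.submatrix id (f₀ ∘ σ.symm)).det
          = ((Equiv.Perm.sign σ : ℤ) : R) * (A.submatrix id f₀).det := by
        have := det_permute' σ.symm (A.submatrix id f₀)
        rwa [submatrix_submatrix, Equiv.Perm.sign_symm] at this
      have h2 : ∏ i, A i ((f₀ ∘ σ.symm) i) = ∏ i, A.submatrix id f₀ (σ i) i := by
        rw [← Equiv.prod_comp σ]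
        simp
      rw [h1, h2]
      ring
  · rw [← Finset.sum_filter, Finset.filter_filter]
    refine Finset.sum_eq_zero fun f hf => ?_
    simp only [Finset.mem_filter, Finset.mem_univ, true_and] at hf
    exact absurd (by rw [← hf.1, Finset.card_image_of_injective _ hf.2, Finset.card_univ]) hT

/-- The index of a sublattice spanned by `r` vectors in a rank `r` lattice. -/
theorem natCard_quotient_span {E m : Type*} [AddCommGroup E] [Fintype m] [DecidableEq m]
    (b : Module.Basis m ℤ E) (w : m → E) (hw : LinearIndependent ℤ w) :
    Nat.card (E ⧸ Submodule.span ℤ (Set.range w)) = (b.det w).natAbs := by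
  have := Module.Free.of_basis b
  have := Module.Finite.of_basis b
  rw [← Submodule.natAbs_det_basis_change b _ (Module.Basis.span hw)]
  congr 2
  ext i
  simp [Module.Basis.span_apply]

theorem linearIndependent_iff_det_ne_zero {E m : Type*} [AddCommGroup E] [Fintype m]
    [DecidableEq m] (b : Module.Basis m ℤ E) (w : m → E) :
    LinearIndependent ℤ w ↔ b.det w ≠ 0 := by
  rw [b.det_apply, ← not_iff_not, not_not, ← exists_mulVec_eq_zero_iff,
    Fintype.not_linearIndependent_iff]
  have key : ∀ v : m → ℤ, (∑ i, v i • w i = 0 ↔ b.toMatrix w *ᵥ v = 0) := fun v => by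
    rw [← b.equivFun.map_eq_zero_iff]
    have : b.equivFun (∑ i, v i • w i) = b.toMatrix w *ᵥ v := by
      ext j
      simp [Matrix.mulVec, dotProduct, Module.Basis.toMatrix_apply, mul_comm,
        Module.Basis.equivFun_apply]
    rw [this]
  constructor
  · rintro ⟨g, hg, i, hi⟩
    exact ⟨g, fun h => hi (congrFun h i), (key g).1 hg⟩
  · rintro ⟨g, hg, h⟩
    exact ⟨g, (key g).2 h, Function.ne_iff.1 hg⟩

theorem finrank_ker_map_intCast {ι κ : Type*} [Fintype ι] [Fintype κ] [DecidableEq κ]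
    (D : Matrix ι κ ℤ) :
    Module.finrank ℚ (LinearMap.ker (toLin' (D.map (Int.cast : ℤ → ℚ)))) =
      Module.finrank ℤ (LinearMap.ker (toLin' D)) := by
  set K := LinearMap.ker (toLin' D)
  set KQ := LinearMap.ker (toLin' (D.map (Int.cast : ℤ → ℚ)))
  let b := Module.finBasis ℤ K
  have hcast : ∀ y : κ → ℤ, toLin' (D.map (Int.cast : ℤ → ℚ)) (fun j => (y j : ℚ))
      = fun i => ((toLin' D y i : ℤ) : ℚ) := by
    intro y
    ext i
    simp [Matrix.mulVec, dotProduct]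
  have hmem : ∀ y : κ → ℤ, (fun j => (y j : ℚ)) ∈ KQ ↔ y ∈ K := by
    intro y
    simp only [K, KQ, LinearMap.mem_ker, hcast]
    simp [funext_iff]
  let φ : K →ₗ[ℤ] KQ :=
    { toFun := fun y => ⟨fun j => ((y : κ → ℤ) j : ℚ), (hmem _).2 y.2⟩
      map_add' := fun x y => by ext; simp
      map_smul' := fun c y => by ext; simp }
  have hφ : Function.Injective φ := fun x y h => by
    ext j
    have := congrFun (congrArg Subtype.val h) j
    simpa [φ] using this
  have hli : LinearIndependent ℚ (φ ∘ b) := by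
    rw [← LinearIndependent.iff_fractionRing ℤ ℚ]
    exact b.linearIndependent.map' φ (LinearMap.ker_eq_bot.2 hφ)
  have hsp : ⊤ ≤ Submodule.span ℚ (Set.range (φ ∘ b)) := by
    intro x _
    obtain ⟨d, hd⟩ := IsLocalization.exist_integer_multiples (nonZeroDivisors ℤ)
      Finset.univ (x : κ → ℚ)
    choose y hy using fun j => hd j (Finset.mem_univ j)
    have hd0 : (d : ℤ) ≠ 0 := nonZeroDivisors.ne_zero d.2
    have hy' : (fun j => (y j : ℚ)) = ((d : ℤ) : ℚ) • (x : κ → ℚ) := by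
      ext j
      simpa using hy j
    have hyK : y ∈ K := (hmem y).1 (hy' ▸ KQ.smul_mem _ x.2)
    have hx : x = ((d : ℤ) : ℚ)⁻¹ • φ ⟨y, hyK⟩ := by
      ext j
      have := congrFun hy' j
      simp only [Pi.smul_apply, smul_eq_mul] at this
      have hd0' : ((d : ℤ) : ℚ) ≠ 0 := by exact_mod_cast hd0
      simp [φ, this, hd0']
    rw [hx, ← b.sum_repr ⟨y, hyK⟩, map_sum]
    refine Submodule.smul_mem _ _ (Submodule.sum_mem _ fun i _ => ?_)
    rw [map_smul, ← Int.cast_smul_eq_zsmul ℚ]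
    exact Submodule.smul_mem _ _ (Submodule.subset_span ⟨i, rfl⟩)
  rw [Module.finrank_eq_card_basis (Module.Basis.mk hli hsp), Fintype.card_fin]

theorem det_square_mul {R ι m : Type*} [CommRing R] [Fintype ι] [DecidableEq ι] [Fintype m]
    [DecidableEq m] (h : Fintype.card ι = Fintype.card m) (W : Matrix ι m R) (X : Matrix m ι R) :
    (W * X).det = (X * W).det := by
  let e : ι ≃ m := Fintype.equivOfCardEq h
  have h1 : W * X = (W.submatrix id e) * (X.submatrix e id) := by
    rw [submatrix_mul_equiv, submatrix_id_id]
  have h2 : (X * W).submatrix e e = (X.submatrix e id) * (W.submatrix id e) := by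
    rw [← submatrix_mul _ _ _ _ _ Function.bijective_id]
  rw [h1, det_mul_comm, ← h2, det_submatrix_equiv_self]

section Splitting

set_option linter.unusedSectionVars false

variable {ι m p : Type*} [Fintype ι] [DecidableEq ι] [Fintype m] [DecidableEq m]
  [Fintype p] [DecidableEq p] {B : Matrix ι m ℤ} {M : Matrix p ι ℤ}
  {P : Matrix m ι ℤ} {S : Matrix ι p ℤ}

theorem det_mul_transpose_ne_zero (hS : M * S = 1) : (M * Mᵀ).det ≠ 0 := by
  intro h
  obtain ⟨v, hv, hv0⟩ := exists_mulVec_eq_zero_iff.2 h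
  apply hv
  have h1 : Mᵀ *ᵥ v = 0 := by
    rw [← dotProduct_self_eq_zero, dotProduct_mulVec, vecMul_transpose, mulVec_mulVec, hv0,
      zero_dotProduct]
  have h2 : (M * S)ᵀ *ᵥ v = 0 := by
    rw [transpose_mul, ← mulVec_mulVec, h1, mulVec_zero]
  simpa [hS] using h2

theorem card_eq_of_splitting (hS : M * S = 1) (hP : P * B = 1) (hMB : M * B = 0)
    (hPS : P * S = 0) (h : B * P + S * M = 1) :
    Fintype.card ι = Fintype.card (m ⊕ p) := by
  refine square_of_invertible (fromCols B S) (fromRows P M) ?_ ?_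
  · rw [fromCols_mul_fromRows, h]
  · rw [fromRows_mul_fromCols, hS, hP, hMB, hPS, fromBlocks_one]

theorem transpose_fromCols_mul_self (hMB : M * B = 0) :
    (fromCols B Mᵀ)ᵀ * fromCols B Mᵀ = fromBlocks (Bᵀ * B) 0 0 (M * Mᵀ) := by
  rw [transpose_fromCols, fromRows_mul_fromCols, transpose_transpose, hMB, ← transpose_mul, hMB,
    transpose_zero]

/-- In a split short exact sequence of lattices, the Gram determinant of the kernel equals the
Gram determinant of the quotient map. -/
theorem det_gram_eq (hS : M * S = 1) (hP : P * B = 1) (hMB : M * B = 0)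
    (hPS : P * S = 0) (h : B * P + S * M = 1) :
    (Bᵀ * B).det = (M * Mᵀ).det := by
  have hc := card_eq_of_splitting hS hP hMB hPS h
  let e : m ⊕ p ≃ ι := Fintype.equivOfCardEq hc.symm
  set W : Matrix (m ⊕ p) (m ⊕ p) ℤ := (fromCols B Mᵀ).submatrix e id with hW
  set W' : Matrix (m ⊕ p) (m ⊕ p) ℤ := (fromRows P M).submatrix id e with hW'
  set U : Matrix (m ⊕ p) (m ⊕ p) ℤ := (fromCols B S).submatrix e id with hU
  have h1 : W'.det * U.det = 1 := by
    rw [← det_mul, hW', hU, submatrix_mul_equiv, submatrix_id_id, fromRows_mul_fromCols, hS, hP,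
      hMB, hPS, fromBlocks_one, det_one]
  have h2 : W'.det * W.det = (M * Mᵀ).det := by
    rw [← det_mul, hW', hW, submatrix_mul_equiv, submatrix_id_id, fromRows_mul_fromCols, hP,
      hMB, det_fromBlocks_zero₂₁, det_one, one_mul]
  have h3 : W.det ^ 2 = (Bᵀ * B).det * (M * Mᵀ).det := by
    rw [sq]
    nth_rewrite 1 [← det_transpose]
    rw [← det_mul, hW, transpose_submatrix, submatrix_mul_equiv, submatrix_id_id,
      transpose_fromCols_mul_self hMB, det_fromBlocks_zero₂₁]
  have h4 : W'.det ^ 2 = 1 := by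
    rcases Int.isUnit_iff.1 (IsUnit.of_mul_eq_one _ h1) with h | h <;> rw [h] <;> norm_num
  have h5 : (M * Mᵀ).det * (M * Mᵀ).det = (Bᵀ * B).det * (M * Mᵀ).det := by
    rw [← h3, ← h2]
    linear_combination (W.det ^ 2) * h4
  exact (mul_right_cancel₀ (det_mul_transpose_ne_zero hS) h5).symm

theorem det_laplacian_eq (hS : M * S = 1) (hP : P * B = 1) (hMB : M * B = 0)
    (hPS : P * S = 0) (h : B * P + S * M = 1) (X : Matrix m m ℤ) (Y : Matrix p p ℤ) :
    (B * X * Bᵀ + Mᵀ * Y * M).det = X.det * Y.det * (M * Mᵀ).det ^ 2 := by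
  have hc := card_eq_of_splitting hS hP hMB hPS h
  have h1 : B * X * Bᵀ + Mᵀ * Y * M =
      fromCols B Mᵀ * (fromBlocks X 0 0 Y * (fromCols B Mᵀ)ᵀ) := by
    rw [← Matrix.mul_assoc, fromCols_mul_fromBlocks, transpose_fromCols, fromCols_mul_fromRows]
    simp
  rw [h1, det_square_mul hc, Matrix.mul_assoc, transpose_fromCols_mul_self hMB, det_mul,
    det_fromBlocks_zero₂₁, det_fromBlocks_zero₂₁, det_gram_eq hS hP hMB hPS h]
  ring

end Splitting

theorem mul_transpose_of_eq {R α β γ : Type*} [CommRing R] [Fintype β] (A : Matrix α β R)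
    (f : γ → β → R) (C : Matrix α γ R) (h : ∀ j, A *ᵥ f j = Cᵀ j) : A * (Matrix.of f)ᵀ = C := by
  ext i j
  exact congrFun (h j) i

theorem eq_of_mul_eq_mul_left {ι m γ : Type*} [Fintype m] {B : Matrix ι m ℤ}
    (hB : ∀ v, B *ᵥ v = 0 → v = 0) {Q Q' : Matrix m γ ℤ} (h : B * Q = B * Q') : Q = Q' := by
  ext i j
  have := hB (fun i => Q i j - Q' i j) (by
    ext l
    have := congrFun (congrFun h l) j
    simp only [Matrix.mul_apply] at this
    simp [Matrix.mulVec, dotProduct, mul_sub, this])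
  exact sub_eq_zero.1 (congrFun this i)

theorem exists_splitting {ι m p : Type*} [Fintype ι] [DecidableEq ι] [Fintype m] [DecidableEq m]
    [Fintype p] [DecidableEq p] {B : Matrix ι m ℤ} {M : Matrix p ι ℤ}
    (hMB : M * B = 0) (hB : ∀ v, B *ᵥ v = 0 → v = 0) (hsurj : ∀ y, ∃ x, M *ᵥ x = y)
    (hex : ∀ x, M *ᵥ x = 0 → ∃ v, B *ᵥ v = x) :
    ∃ (P : Matrix m ι ℤ) (S : Matrix ι p ℤ),
      M * S = 1 ∧ P * B = 1 ∧ P * S = 0 ∧ B * P + S * M = 1 := by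
  choose s hs using fun j : p => hsurj (Pi.single j 1)
  set S : Matrix ι p ℤ := (Matrix.of s)ᵀ with hSdef
  have hS : M * S = 1 := mul_transpose_of_eq M s 1 fun j => by
    rw [hs]
    ext i
    simp [Matrix.one_apply, Pi.single_apply]
  have hker : M * (1 - S * M) = 0 := by
    rw [Matrix.mul_sub, ← Matrix.mul_assoc, hS]
    simp
  choose q hq using fun j : ι => hex ((1 - S * M)ᵀ j) (by
    ext i
    exact congrFun (congrFun hker i) j)
  have hP : B * (Matrix.of q)ᵀ = 1 - S * M := mul_transpose_of_eq B q _ hq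
  refine ⟨(Matrix.of q)ᵀ, S, hS, ?_, ?_, ?_⟩
  · apply eq_of_mul_eq_mul_left hB
    rw [← Matrix.mul_assoc, hP, Matrix.sub_mul, Matrix.mul_assoc, hMB]
    simp
  · apply eq_of_mul_eq_mul_left hB
    rw [← Matrix.mul_assoc, hP, Matrix.sub_mul, Matrix.mul_assoc, hS]
    simp
  · rw [hP]
    simp

/-- Tree counting over an arbitrary lattice `Z`: the sum of the squared indices of the full rank
sublattices spanned by columns of `D` is a Gram determinant. -/
theorem sum_sq_natCard_quotient {ι κ m : Type*} [Fintype m] [DecidableEq m]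
    [Fintype κ] [DecidableEq κ] (Z : Submodule ℤ (ι → ℤ)) (b : Module.Basis m ℤ Z)
    (D : Matrix ι κ ℤ) (w : κ → Z) (hw : ∀ t, (w t : ι → ℤ) = Dᵀ t)
    (tree : Finset κ → Prop) [DecidablePred tree]
    (htree : ∀ T, tree T ↔ LinearIndependent ℤ (fun t : {σ // σ ∈ T} => Dᵀ (t : κ)) ∧
      Nat.card (Z ⧸ (Submodule.span ℤ ((fun t => Dᵀ t) '' (T : Set κ))).comap Z.subtype) ≠ 0 ∧
      T.card = Fintype.card m) :
    ((∑ T : Finset κ, if tree T then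
      Nat.card (Z ⧸ (Submodule.span ℤ ((fun t => Dᵀ t) '' (T : Set κ))).comap Z.subtype) ^ 2
      else 0 : ℕ) : ℤ) =
    (b.toMatrix w * (b.toMatrix w)ᵀ).det := by
  set c : Finset κ → ℕ := fun T =>
    Nat.card (Z ⧸ (Submodule.span ℤ ((fun t => Dᵀ t) '' (T : Set κ))).comap Z.subtype) with hc
  rw [det_mul_transpose_eq_sum (b.toMatrix w) (fun T => ((if tree T then c T ^ 2 else 0 : ℕ) : ℤ))]
  · push_cast
    refine Finset.sum_congr rfl fun T _ => ?_
    by_cases h : tree T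
    · rw [if_pos h, if_pos ((htree T).1 h).2.2]
    · simp [h]
  · intro f hf
    have hli : LinearIndependent ℤ
        (fun t : {σ // σ ∈ Finset.univ.image f} => Dᵀ (t : κ)) ↔
        LinearIndependent ℤ (w ∘ f) := by
      let e : m ≃ {σ // σ ∈ Finset.univ.image f} :=
        Equiv.ofBijective (fun i => ⟨f i, Finset.mem_image_of_mem f (Finset.mem_univ i)⟩)
          ⟨fun i j h => hf (congrArg Subtype.val h), fun ⟨x, hx⟩ => by
            obtain ⟨i, _, rfl⟩ := Finset.mem_image.1 hx
            exact ⟨i, rfl⟩⟩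
      rw [← linearIndependent_equiv e,
        ← LinearMap.linearIndependent_iff Z.subtype (Submodule.ker_subtype Z)]
      have : (fun t : {σ // σ ∈ Finset.univ.image f} => Dᵀ (t : κ)) ∘ e
          = Z.subtype ∘ w ∘ f := by
        ext1 i
        exact (hw (f i)).symm
      rw [this]
    have hspan : (Submodule.span ℤ
        ((fun t => Dᵀ t) '' ((Finset.univ.image f : Finset κ) : Set κ))).comap Z.subtype =
        Submodule.span ℤ (Set.range (w ∘ f)) := by
      have : (fun t => Dᵀ t) '' ((Finset.univ.image f : Finset κ) : Set κ)
          = Z.subtype '' Set.range (w ∘ f) := by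
        rw [Finset.coe_image, Finset.coe_univ, Set.image_univ, ← Set.range_comp, ← Set.range_comp]
        congr 1
        ext1 i
        exact (hw (f i)).symm
      rw [this, Submodule.span_image,
        Submodule.comap_map_eq_of_injective (Submodule.subtype_injective Z)]
    have hdet : ((b.toMatrix w).submatrix id f).det = b.det (w ∘ f) := by
      rw [b.det_apply]
      rfl
    have hcard : (Finset.univ.image f).card = Fintype.card m := by
      rw [Finset.card_image_of_injective _ hf, Finset.card_univ]
    rw [hdet]
    by_cases h : LinearIndependent ℤ (w ∘ f)
    · have hcf : c (Finset.univ.image f) = (b.det (w ∘ f)).natAbs := by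
        rw [← natCard_quotient_span b _ h, hc]
        simp only [hspan]
      have ht : tree (Finset.univ.image f) := by
        refine (htree _).2 ⟨hli.2 h, ?_, hcard⟩
        change c _ ≠ 0
        rw [hcf]
        exact Int.natAbs_ne_zero.2 ((linearIndependent_iff_det_ne_zero b _).1 h)
      rw [if_pos ht, hcf]
      push_cast
      exact sq_abs _
    · have h0 : b.det (w ∘ f) = 0 := by
        by_contra h0
        exact h ((linearIndependent_iff_det_ne_zero b _).2 h0)
      have ht : ¬ tree (Finset.univ.image f) := fun ht => h (hli.1 ((htree _).1 ht).1)
      rw [if_neg ht, h0]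
      norm_num

/-- The tree count is the Gram determinant of the boundary map, corestricted to the cycles. -/
theorem tau_eq_det (col : V → Fin n) (hdd : ∀ k, bdCol col k * bdCol col (k + 1) = 0) (k : ℕ) :
    ∃ w : ColFace col (k + 1) → ZcC col k, (∀ t, (w t : ColFace col k → ℤ) = (bdCol col k)ᵀ t) ∧
    (tauCol col k : ℤ) = ((Module.finBasis ℤ (ZcC col k)).toMatrix w *
      ((Module.finBasis ℤ (ZcC col k)).toMatrix w)ᵀ).det := by
  classical
  have hmem : ∀ t, (bdCol col k)ᵀ t ∈ ZcC col k := by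
    intro t
    cases k with
    | zero => exact Submodule.mem_top
    | succ j =>
      rw [ZcC, LinearMap.mem_ker, toLin'_apply]
      ext i
      exact congrFun (congrFun (hdd j) i) t
  have hrank : Module.finrank ℚ (ZcCQ col k) = Module.finrank ℤ (ZcC col k) := by
    cases k with
    | zero =>
      rw [ZcC, ZcCQ, finrank_top, finrank_top, Module.finrank_fintype_fun_eq_card,
        Module.finrank_fintype_fun_eq_card]
    | succ j => exact finrank_ker_map_intCast _
  refine ⟨fun t => ⟨_, hmem t⟩, fun t => rfl, ?_⟩
  rw [tauCol]
  refine Eq.trans ?_ (sum_sq_natCard_quotient (ZcC col k) (Module.finBasis ℤ (ZcC col k))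
    (bdCol col k) (fun t => ⟨_, hmem t⟩) (fun t => rfl) (IsTreeCol col k) fun T => ?_)
  · rfl
  · rw [IsTreeCol, hrank, Fintype.card_fin]

/-- The basis matrix of the lattice of cycles. -/
noncomputable def cycleMatrix (col : V → Fin n) (k : ℕ) :
    Matrix (ColFace col k) (Fin (Module.finrank ℤ (ZcC col k))) ℤ :=
  Matrix.of fun i j => (Module.finBasis ℤ (ZcC col k) j : ColFace col k → ℤ) i

theorem cycleMatrix_mulVec (col : V → Fin n) (k : ℕ)
    (v : Fin (Module.finrank ℤ (ZcC col k)) → ℤ) :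
    cycleMatrix col k *ᵥ v = ((∑ j, v j • Module.finBasis ℤ (ZcC col k) j : ZcC col k) :
      ColFace col k → ℤ) := by
  ext i
  simp [cycleMatrix, Matrix.mulVec, dotProduct, mul_comm]

theorem cycleMatrix_injective (col : V → Fin n) (k : ℕ)
    (v : Fin (Module.finrank ℤ (ZcC col k)) → ℤ) (h : cycleMatrix col k *ᵥ v = 0) : v = 0 := by
  rw [cycleMatrix_mulVec] at h
  have h' : ∑ j, v j • Module.finBasis ℤ (ZcC col k) j = 0 := Subtype.ext h
  exact funext (Fintype.linearIndependent_iff.1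
    (Module.finBasis ℤ (ZcC col k)).linearIndependent v h')

theorem exists_cycleMatrix_mulVec (col : V → Fin n) (k : ℕ) {z : ColFace col k → ℤ}
    (hz : z ∈ ZcC col k) : ∃ v, cycleMatrix col k *ᵥ v = z := by
  refine ⟨(Module.finBasis ℤ (ZcC col k)).equivFun ⟨z, hz⟩, ?_⟩
  rw [cycleMatrix_mulVec, Module.Basis.sum_equivFun]

theorem cycleMatrix_mulVec_mem (col : V → Fin n) (k : ℕ)
    (v : Fin (Module.finrank ℤ (ZcC col k)) → ℤ) : cycleMatrix col k *ᵥ v ∈ ZcC col k := by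
  rw [cycleMatrix_mulVec]
  exact Subtype.property _

/-- The Gram determinant (squared covolume) of the lattice of cycles. -/
noncomputable def cycleGram (col : V → Fin n) (k : ℕ) : ℤ :=
  ((cycleMatrix col k)ᵀ * cycleMatrix col k).det

theorem exists_corestrict (col : V → Fin n)
    (hdd : ∀ k, bdCol col k * bdCol col (k + 1) = 0) (k : ℕ) :
    ∃ M : Matrix (Fin (Module.finrank ℤ (ZcC col k))) (ColFace col (k + 1)) ℤ,
      bdCol col k = cycleMatrix col k * M ∧ (tauCol col k : ℤ) = (M * Mᵀ).det := by
  obtain ⟨w, hw, htau⟩ := tau_eq_det col hdd k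
  refine ⟨_, ?_, htau⟩
  ext i t
  have h := cycleMatrix_mulVec col k ((Module.finBasis ℤ (ZcC col k)).equivFun (w t))
  rw [Module.Basis.sum_equivFun, hw] at h
  exact (congrFun h i).symm

theorem cycleGram_zero (col : V → Fin n) : cycleGram col 0 = 1 := by
  have hex : ∀ z, ∃ v, cycleMatrix col 0 *ᵥ v = z := fun z =>
    exists_cycleMatrix_mulVec col 0 Submodule.mem_top
  choose q hq using hex
  have h1 := mul_transpose_of_eq (cycleMatrix col 0)
    (fun i : ColFace col 0 => q (Pi.single i 1)) 1 (fun j => by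
      rw [hq]
      ext i
      simp [Matrix.one_apply, Pi.single_apply])
  set Q := (Matrix.of fun i : ColFace col 0 => q (Pi.single i 1))ᵀ
  have h2 : Q * cycleMatrix col 0 = 1 := by
    apply eq_of_mul_eq_mul_left (cycleMatrix_injective col 0)
    rw [← Matrix.mul_assoc, h1, Matrix.one_mul, Matrix.mul_one]
  have hcard := square_of_invertible _ _ h1 h2
  have hu : IsUnit (cycleGram col 0) := by
    refine IsUnit.of_mul_eq_one (Q * Qᵀ).det ?_
    rw [cycleGram, ← det_mul, Matrix.mul_assoc, ← Matrix.mul_assoc _ Q, h1, Matrix.one_mul,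
      ← transpose_mul, h2, transpose_one, det_one]
  rcases Int.isUnit_iff.1 hu with h | h
  · exact h
  · exfalso
    have hsq : cycleGram col 0 = (cycleMatrix col 0 * (cycleMatrix col 0)ᵀ).det :=
      (det_square_mul hcard _ _).symm
    let e := Fintype.equivOfCardEq hcard
    have : cycleGram col 0 = ((cycleMatrix col 0).submatrix id e).det ^ 2 := by
      rw [hsq, sq]
      nth_rewrite 3 [← det_transpose]
      rw [← det_mul, transpose_submatrix, submatrix_mul_equiv, submatrix_id_id]
    have := sq_nonneg ((cycleMatrix col 0).submatrix id e).det
    omega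

theorem det_bdCol_zero (col : V → Fin n) (hdd : ∀ k, bdCol col k * bdCol col (k + 1) = 0) :
    (bdCol col 0 * (bdCol col 0)ᵀ).det = tauCol col 0 := by
  obtain ⟨M, hM, ht⟩ := exists_corestrict col hdd 0
  have hcard : Fintype.card (ColFace col 0) =
      Fintype.card (Fin (Module.finrank ℤ (ZcC col 0))) := by
    rw [Fintype.card_fin, ZcC, finrank_top, Module.finrank_fintype_fun_eq_card]
  rw [hM, transpose_mul, Matrix.mul_assoc, det_square_mul hcard, ← Matrix.mul_assoc,
    Matrix.mul_assoc, det_mul, ← ht]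
  change _ * cycleGram col 0 = _
  rw [cycleGram_zero, mul_one]

/-- Under exactness, the total Laplacian determinant factors into tree counts, and the squared
covolume of the next cycle lattice is a tree count. -/
theorem det_laplacian_bdCol (col : V → Fin n) (hdd : ∀ k, bdCol col k * bdCol col (k + 1) = 0)
    (k : ℕ) (hex : ∀ z ∈ ZcC col k, ∃ y, bdCol col k *ᵥ y = z) :
    (bdCol col (k + 1) * (bdCol col (k + 1))ᵀ + (bdCol col k)ᵀ * bdCol col k).det =
      tauCol col (k + 1) * tauCol col k ^ 2 * cycleGram col k ∧
    cycleGram col (k + 1) = tauCol col k := by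
  obtain ⟨M, hM, ht⟩ := exists_corestrict col hdd k
  obtain ⟨M', hM', ht'⟩ := exists_corestrict col hdd (k + 1)
  have hinj := cycleMatrix_injective col k
  have hMB : M * cycleMatrix col (k + 1) = 0 := by
    apply eq_of_mul_eq_mul_left hinj
    rw [← Matrix.mul_assoc, ← hM, Matrix.mul_zero]
    ext i j
    have : toLin' (bdCol col k) (cycleMatrix col (k + 1) *ᵥ Pi.single j 1) = 0 :=
      cycleMatrix_mulVec_mem col (k + 1) (Pi.single j 1)
    rw [toLin'_apply, mulVec_mulVec] at this
    simpa using congrFun this i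
  have hsurj : ∀ y, ∃ x, M *ᵥ x = y := by
    intro y
    obtain ⟨x, hx⟩ := hex _ (cycleMatrix_mulVec_mem col k y)
    refine ⟨x, ?_⟩
    rw [← sub_eq_zero]
    apply hinj
    rw [mulVec_sub, mulVec_mulVec, ← hM, hx, sub_self]
  have hker : ∀ x, M *ᵥ x = 0 → ∃ v, cycleMatrix col (k + 1) *ᵥ v = x := by
    intro x hx
    apply exists_cycleMatrix_mulVec
    rw [ZcC, LinearMap.mem_ker, toLin'_apply, hM, ← mulVec_mulVec, hx, mulVec_zero]
  obtain ⟨P, S, hS, hP, hPS, h⟩ :=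
    exists_splitting hMB (cycleMatrix_injective col (k + 1)) hsurj hker
  refine ⟨?_, ?_⟩
  · have key := det_laplacian_eq hS hP hMB hPS h (M' * M'ᵀ)
      ((cycleMatrix col k)ᵀ * cycleMatrix col k)
    rw [← ht, ← ht'] at key
    have e1 : bdCol col (k + 1) * (bdCol col (k + 1))ᵀ =
        cycleMatrix col (k + 1) * (M' * M'ᵀ) * (cycleMatrix col (k + 1))ᵀ := by
      rw [hM', transpose_mul]
      simp only [Matrix.mul_assoc]
    have e2 : (bdCol col k)ᵀ * bdCol col k =
        Mᵀ * ((cycleMatrix col k)ᵀ * cycleMatrix col k) * M := by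
      rw [hM, transpose_mul]
      simp only [Matrix.mul_assoc]
    rw [e1, e2, key, cycleGram]
    ring
  · rw [cycleGram, det_gram_eq hS hP hMB hPS h, ht]

section Kronecker

set_option linter.unusedSectionVars false

variable {R I : Type*} [CommRing R] [Fintype I] [DecidableEq I] {α : I → Type*}
  [∀ i, Fintype (α i)] [∀ i, DecidableEq (α i)]

/-- The Kronecker product of a finite family of square matrices. -/
def piKron (m : ∀ i, Matrix (α i) (α i) R) : Matrix (∀ i, α i) (∀ i, α i) R :=
  Matrix.of fun g h => ∏ i, m i (g i) (h i)

theorem piKron_mul (m m' : ∀ i, Matrix (α i) (α i) R) :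
    piKron m * piKron m' = piKron fun i => m i * m' i := by
  ext g g'
  simp only [piKron, Matrix.mul_apply, Matrix.of_apply, ← Finset.prod_mul_distrib]
  rw [Finset.prod_univ_sum, Fintype.piFinset_univ]

theorem piKron_one : piKron (fun i => (1 : Matrix (α i) (α i) R)) = 1 := by
  ext g g'
  simp only [piKron, Matrix.of_apply, Matrix.one_apply]
  rw [Finset.prod_ite_zero]
  simp [funext_iff]

theorem piKron_transpose (m : ∀ i, Matrix (α i) (α i) R) :
    (piKron m)ᵀ = piKron fun i => (m i)ᵀ := rfl

theorem piKron_neg_of_eq (m m' : ∀ i, Matrix (α i) (α i) R) (i : I) (hi : m' i = -m i)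
    (h : ∀ j, j ≠ i → m' j = m j) : piKron m' = -piKron m := by
  ext g g'
  simp only [piKron, Matrix.of_apply, Matrix.neg_apply]
  rw [← Finset.mul_prod_erase _ _ (Finset.mem_univ i),
    ← Finset.mul_prod_erase Finset.univ (fun j => m j (g j) (g' j)) (Finset.mem_univ i), hi,
    Matrix.neg_apply, neg_mul]
  congr 2
  exact Finset.prod_congr rfl fun j hj => by rw [h j (Finset.ne_of_mem_erase hj)]

/-- The operator acting as `a` on the tensor factor `i` and as the identity elsewhere. -/
def piLift (i : I) (a : Matrix (α i) (α i) R) : Matrix (∀ i, α i) (∀ i, α i) R :=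
  piKron (Function.update (fun _ => 1) i a)

theorem piLift_apply (i : I) (a : Matrix (α i) (α i) R) (g g' : ∀ i, α i) :
    piLift i a g g' = a (g i) (g' i) * ∏ j ∈ Finset.univ.erase i, if g j = g' j then 1 else 0 := by
  simp only [piLift, piKron, Matrix.of_apply]
  rw [← Finset.mul_prod_erase _ _ (Finset.mem_univ i), Function.update_self]
  congr 1
  refine Finset.prod_congr rfl fun j hj => ?_
  rw [Function.update_of_ne (Finset.ne_of_mem_erase hj), Matrix.one_apply]

theorem piLift_add (i : I) (a b : Matrix (α i) (α i) R) :
    piLift i (a + b) = piLift i a + piLift i b := by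
  ext g g'
  simp only [Matrix.add_apply, piLift_apply, add_mul]

theorem piLift_one (i : I) : piLift i (1 : Matrix (α i) (α i) R) = 1 := by
  rw [piLift, ← piKron_one]
  congr 1
  exact Function.update_eq_self i _

theorem piLift_mul_piKron (i : I) (a : Matrix (α i) (α i) R) (m : ∀ i, Matrix (α i) (α i) R) :
    piLift i a * piKron m = piKron (Function.update m i (a * m i)) := by
  rw [piLift, piKron_mul]
  congr 1
  ext1 j
  by_cases h : j = i
  · subst h; simp
  · simp [h]

theorem piKron_mul_piLift (i : I) (a : Matrix (α i) (α i) R) (m : ∀ i, Matrix (α i) (α i) R) :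
    piKron m * piLift i a = piKron (Function.update m i (m i * a)) := by
  rw [piLift, piKron_mul]
  congr 1
  ext1 j
  by_cases h : j = i
  · subst h; simp
  · simp [h]

theorem piLift_diagonal (i : I) (c : α i → R) :
    piLift i (diagonal c) = diagonal fun g : ∀ i, α i => c (g i) := by
  ext g g'
  rw [piLift_apply, diagonal_apply, diagonal_apply]
  by_cases h : g = g'
  · subst h; simp
  · rw [if_neg h]
    by_cases hi : g i = g' i
    · obtain ⟨j, hj⟩ := Function.ne_iff.1 h
      rw [Finset.prod_eq_zero (i := j), mul_zero]
      · exact Finset.mem_erase.2 ⟨fun hji => hj (hji ▸ hi), Finset.mem_univ _⟩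
      · rw [if_neg hj]
    · rw [if_neg hi, zero_mul]

end Kronecker

section JordanWigner

set_option linter.unusedSectionVars false

variable {R : Type*} [CommRing R] {n : ℕ} {W : Fin n → Type*}
  [∀ i, Fintype (W i)] [∀ i, DecidableEq (W i)]

/-- The parity operator on `Option X`. -/
def parity (R X : Type*) [CommRing R] [DecidableEq X] : Matrix (Option X) (Option X) R :=
  diagonal fun x => if x.isSome then -1 else 1

/-- The augmentation of a discrete set `X`, with `none` standing for the empty face. -/
def aug (R X : Type*) [CommRing R] : Matrix (Option X) (Option X) R :=
  Matrix.of fun x y => if x.isSome then 0 else if y.isSome then 1 else 0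

/-- The cone operator towards a base point. -/
def cone (R : Type*) {X : Type*} [CommRing R] [DecidableEq X] (b : X) :
    Matrix (Option X) (Option X) R :=
  Matrix.of fun x y => if x = some b ∧ y = none then 1 else 0

theorem parity_mul_self (X : Type*) [Fintype X] [DecidableEq X] :
    parity R X * parity R X = 1 := by
  rw [parity, diagonal_mul_diagonal, ← diagonal_one]
  congr 1
  ext x
  cases x <;> simp

theorem parity_mul_aug (X : Type*) [Fintype X] [DecidableEq X] :
    parity R X * aug R X = -(aug R X * parity R X) := by
  ext x y
  rw [parity, diagonal_mul, Matrix.neg_apply, mul_diagonal]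
  cases x <;> cases y <;> simp [aug]

theorem parity_mul_aug_transpose (X : Type*) [Fintype X] [DecidableEq X] :
    parity R X * (aug R X)ᵀ = -((aug R X)ᵀ * parity R X) := by
  ext x y
  rw [parity, diagonal_mul, Matrix.neg_apply, mul_diagonal]
  cases x <;> cases y <;> simp [aug]

theorem parity_mul_cone {X : Type*} [Fintype X] [DecidableEq X] (b : X) :
    parity R X * cone R b = -(cone R b * parity R X) := by
  ext x y
  rw [parity, diagonal_mul, Matrix.neg_apply, mul_diagonal]
  cases x <;> cases y <;> simp [cone]
  split_ifs <;> simp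

/-- The odd operator `a` on the tensor factor `i`, twisted by the parities of the smaller factors. -/
def twist (i : Fin n) (a : Matrix (Option (W i)) (Option (W i)) R) :
    Matrix (∀ i, Option (W i)) (∀ i, Option (W i)) R :=
  piKron (Function.update (fun j => if j < i then parity R (W j) else 1) i a)

theorem twist_transpose (i : Fin n) (a : Matrix (Option (W i)) (Option (W i)) R) :
    (twist i a)ᵀ = twist i aᵀ := by
  rw [twist, twist, piKron_transpose]
  congr 1
  ext1 j
  by_cases h : j = i
  · subst h; simp
  · by_cases h' : j < i <;> simp [h, h', parity]

theorem twist_mul_self (i : Fin n) (a b : Matrix (Option (W i)) (Option (W i)) R) :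
    twist i a * twist i b = piLift i (a * b) := by
  rw [twist, twist, piLift, piKron_mul]
  congr 1
  ext1 j
  by_cases h : j = i
  · subst h; simp
  · by_cases h' : j < i <;> simp [h, h', parity_mul_self]

theorem twist_anticomm {i j : Fin n} (hij : i ≠ j)
    (a : Matrix (Option (W i)) (Option (W i)) R) (b : Matrix (Option (W j)) (Option (W j)) R)
    (ha : parity R (W i) * a = -(a * parity R (W i)))
    (hb : parity R (W j) * b = -(b * parity R (W j))) :
    twist i a * twist j b = -(twist j b * twist i a) := by
  rw [twist, twist, piKron_mul, piKron_mul]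
  rcases lt_or_gt_of_ne hij with h | h
  · refine piKron_neg_of_eq _ _ i ?_ ?_
    · simp [h, hij, ha]
    · intro l hl
      by_cases hlj : l = j
      · subst hlj
        simp [hl, h.not_gt]
      · by_cases h1 : l < i <;> by_cases h2 : l < j <;> simp [hl, hlj, h1, h2]
  · refine piKron_neg_of_eq _ _ j ?_ ?_
    · simp [h, hij.symm, hb]
    · intro l hl
      by_cases hlj : l = i
      · subst hlj
        simp [hl, h.not_gt]
      · by_cases h1 : l < i <;> by_cases h2 : l < j <;> simp [hl, hlj, h1, h2]

theorem sum_twist_anticomm (a b : ∀ i, Matrix (Option (W i)) (Option (W i)) R)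
    (ha : ∀ i, parity R (W i) * a i = -(a i * parity R (W i)))
    (hb : ∀ i, parity R (W i) * b i = -(b i * parity R (W i))) :
    (∑ i, twist i (a i)) * (∑ i, twist i (b i)) + (∑ i, twist i (b i)) * (∑ i, twist i (a i)) =
      ∑ i, piLift i (a i * b i + b i * a i) := by
  rw [Finset.sum_mul_sum, Finset.sum_mul_sum, Finset.sum_comm (f := fun i j =>
    twist i (b i) * twist j (a j)), ← Finset.sum_add_distrib]
  refine Finset.sum_congr rfl fun i _ => ?_
  rw [← Finset.sum_add_distrib, Finset.sum_eq_single i]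
  · rw [twist_mul_self, twist_mul_self, piLift_add]
  · intro j _ hj
    rw [twist_anticomm hj.symm _ _ (ha i) (hb j), neg_add_cancel]
  · simp

/-- The boundary operator of the complete colorful complex, signs following the color order. -/
def colorBd (R : Type*) [CommRing R] (W : Fin n → Type*) [∀ i, Fintype (W i)]
    [∀ i, DecidableEq (W i)] : Matrix (∀ i, Option (W i)) (∀ i, Option (W i)) R :=
  ∑ i, twist i (aug R (W i))

theorem aug_mul_self (X : Type*) [Fintype X] [DecidableEq X] : aug R X * aug R X = 0 := by
  ext x y
  rw [Matrix.mul_apply]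
  refine Finset.sum_eq_zero fun t _ => ?_
  cases t <;> simp [aug]

theorem colorBd_mul_self : colorBd ℤ W * colorBd ℤ W = 0 := by
  have h := sum_twist_anticomm (fun i => aug ℤ (W i)) (fun i => aug ℤ (W i))
    (fun i => parity_mul_aug _) (fun i => parity_mul_aug _)
  have h0 : ∀ i : Fin n, piLift (α := fun i => Option (W i)) i
      (aug ℤ (W i) * aug ℤ (W i) + aug ℤ (W i) * aug ℤ (W i)) = 0 := by
    intro i
    ext g g'
    rw [piLift_apply, aug_mul_self]
    simp
  rw [Finset.sum_eq_zero fun i _ => h0 i] at h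
  ext g g'
  have := congrFun (congrFun h g) g'
  simp only [Matrix.add_apply, Matrix.zero_apply] at this
  rw [Matrix.zero_apply, colorBd]
  omega

theorem colorBd_laplacian : colorBd R W * (colorBd R W)ᵀ + (colorBd R W)ᵀ * colorBd R W =
    ∑ i, piLift i (aug R (W i) * (aug R (W i))ᵀ + (aug R (W i))ᵀ * aug R (W i)) := by
  have ht : (colorBd R W)ᵀ = ∑ i, twist i (aug R (W i))ᵀ := by
    rw [colorBd, transpose_sum]
    exact Finset.sum_congr rfl fun i _ => twist_transpose i _
  rw [ht, colorBd]
  exact sum_twist_anticomm _ _ (fun i => parity_mul_aug _) fun i => parity_mul_aug_transpose _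

theorem colorBd_homotopy (i : Fin n) (b : W i) :
    colorBd R W * twist i (cone R b) + twist i (cone R b) * colorBd R W =
      piLift i (aug R (W i) * cone R b + cone R b * aug R (W i)) := by
  rw [colorBd, Finset.sum_mul, Finset.mul_sum, ← Finset.sum_add_distrib, Finset.sum_eq_single i]
  · rw [twist_mul_self, twist_mul_self, piLift_add]
  · intro j _ hj
    rw [twist_anticomm hj _ _ (parity_mul_aug _) (parity_mul_cone _), neg_add_cancel]
  · simp

/-- The projection killing the empty face of one color class. -/
def coneProj (R : Type*) {X : Type*} [CommRing R] [Fintype X] [DecidableEq X] (b : X) :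
    Matrix (Option X) (Option X) R :=
  1 - (aug R X * cone R b + cone R b * aug R X)

theorem coneProj_apply_none {X : Type*} [Fintype X] [DecidableEq X] (b : X) (x : Option X) :
    coneProj R b x none = 0 := by
  have h1 : (aug R X * cone R b) x none = if x = none then 1 else 0 := by
    rw [Matrix.mul_apply, Finset.sum_eq_single (some b)]
    · cases x <;> simp [aug, cone]
    · intro t _ ht
      simp [cone, ht]
    · simp
  have h2 : (cone R b * aug R X) x none = 0 := by
    rw [Matrix.mul_apply]
    exact Finset.sum_eq_zero fun t _ => by cases t <;> simp [aug]
  rw [coneProj, Matrix.sub_apply, Matrix.add_apply, h1, h2, Matrix.one_apply]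
  simp

theorem exists_colorBd_eq (b : ∀ i, W i) (z : (∀ i, Option (W i)) → ℤ)
    (hz : colorBd ℤ W *ᵥ z = 0) (hsupp : ∀ g, (∀ i, g i ≠ none) → z g = 0) :
    ∃ y, colorBd ℤ W *ᵥ y = z := by
  have key : ∀ s : Finset (Fin n), ∃ y,
      z = piKron (fun i => if i ∈ s then coneProj ℤ (b i) else 1) *ᵥ z + colorBd ℤ W *ᵥ y := by
    intro s
    induction s using Finset.induction_on with
    | empty => exact ⟨0, by simp [piKron_one]⟩
    | insert i s hi ih =>
      obtain ⟨y, hy⟩ := ih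
      set z' := piKron (fun i => if i ∈ s then coneProj ℤ (b i) else 1) *ᵥ z with hz'
      have hE : colorBd ℤ W *ᵥ z' = 0 := by
        have : z' = z - colorBd ℤ W *ᵥ y := eq_sub_of_add_eq hy.symm
        rw [this, mulVec_sub, hz, mulVec_mulVec, colorBd_mul_self]
        simp
      have hh : colorBd ℤ W *ᵥ (twist i (cone ℤ (b i)) *ᵥ z') + piLift i (coneProj ℤ (b i)) *ᵥ z'
          = z' := by
        have h1 := congrArg (· *ᵥ z') (colorBd_homotopy (R := ℤ) i (b i))
        simp only [add_mulVec, ← mulVec_mulVec, hE, mulVec_zero, add_zero] at h1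
        rw [h1, ← add_mulVec, ← piLift_add, coneProj, add_sub_cancel, piLift_one, one_mulVec]
      refine ⟨twist i (cone ℤ (b i)) *ᵥ z' + y, ?_⟩
      have hk : piKron (fun j => if j ∈ insert i s then coneProj ℤ (b j) else 1) *ᵥ z =
          piLift i (coneProj ℤ (b i)) *ᵥ z' := by
        rw [hz', mulVec_mulVec, piLift_mul_piKron]
        congr 2
        ext1 j
        by_cases h : j = i
        · subst h; simp [hi]
        · simp [h]
      rw [hk, mulVec_add, ← add_assoc, add_comm (piLift i _ *ᵥ z'), hh]
      exact hy
  obtain ⟨y, hy⟩ := key Finset.univ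
  refine ⟨y, (hy.trans ?_).symm⟩
  rw [add_eq_right]
  ext g
  refine Finset.sum_eq_zero fun h _ => ?_
  by_cases hn : ∀ i, h i ≠ none
  · rw [hsupp h hn, mul_zero]
  · push Not at hn
    obtain ⟨i, hi⟩ := hn
    refine mul_eq_zero_of_left (Finset.prod_eq_zero (Finset.mem_univ i) ?_) _
    simp only [Finset.mem_univ, if_true, hi, coneProj_apply_none]

end JordanWigner

section Spectrum

set_option linter.unusedSectionVars false

variable {n : ℕ} {W : Fin n → Type*} [∀ i, Fintype (W i)] [∀ i, DecidableEq (W i)]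

/-- Eigenvectors of the Laplacian of a discrete set with base point `b`. -/
def eigvec {X : Type*} [DecidableEq X] (b : X) : Matrix (Option X) (Option X) ℚ :=
  Matrix.of fun x y => match x, y with
    | none, none => 1
    | none, some _ => 0
    | some _, none => 0
    | some v, some w => if w = b then 1 else (if v = w then 1 else 0) - (if v = b then 1 else 0)

/-- The inverse of `eigvec`. -/
def eigvecInv {X : Type*} [Fintype X] [DecidableEq X] (b : X) :
    Matrix (Option X) (Option X) ℚ :=
  Matrix.of fun x y => match x, y with
    | none, none => 1
    | none, some _ => 0
    | some _, none => 0
    | some w, some v => if w = b then (Fintype.card X : ℚ)⁻¹ else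
        (if v = w then 1 else 0) - (Fintype.card X : ℚ)⁻¹

/-- The Laplacian eigenvalue attached to a vertex (or the empty face) of a discrete set. -/
def eigval {X : Type*} [Fintype X] [DecidableEq X] (b : X) (x : Option X) : ℕ :=
  if x = none ∨ x = some b then Fintype.card X else 0

theorem eigvecInv_mul {X : Type*} [Fintype X] [DecidableEq X] (b : X) :
    eigvecInv b * eigvec b = 1 := by
  have hX : (Fintype.card X : ℚ) ≠ 0 := by
    have : Nonempty X := ⟨b⟩
    exact_mod_cast Fintype.card_ne_zero
  ext x y
  rw [Matrix.mul_apply, Fintype.sum_option]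
  cases x with
  | none => cases y <;> simp [eigvec, eigvecInv]
  | some w =>
    cases y with
    | none => simp [eigvec, eigvecInv]
    | some v =>
      by_cases hw : w = b <;> by_cases hv : v = b
      · subst hw; subst hv
        simp [eigvec, eigvecInv, hX]
      · subst hw
        have : w ≠ v := Ne.symm hv
        simp [eigvec, eigvecInv, hv, mul_sub, this]
      · subst hv
        simp [eigvec, eigvecInv, hw, hX]
      · simp [eigvec, eigvecInv, hw, mul_sub, Matrix.one_apply, eq_comm,
          Ne.symm hw, Ne.symm hv]

theorem laplacian_mul_eigvec {X : Type*} [Fintype X] [DecidableEq X] (b : X) :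
    (aug ℚ X * (aug ℚ X)ᵀ + (aug ℚ X)ᵀ * aug ℚ X) * eigvec b =
      eigvec b * diagonal fun x => (eigval b x : ℚ) := by
  have hL : aug ℚ X * (aug ℚ X)ᵀ + (aug ℚ X)ᵀ * aug ℚ X = Matrix.of fun x y =>
      match x, y with
      | none, none => (Fintype.card X : ℚ)
      | none, some _ => 0
      | some _, none => 0
      | some _, some _ => 1 := by
    ext x y
    rw [Matrix.add_apply, Matrix.mul_apply, Matrix.mul_apply, Fintype.sum_option,
      Fintype.sum_option]
    cases x <;> cases y <;> simp [aug]
  rw [hL]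
  ext x y
  rw [mul_diagonal, Matrix.mul_apply, Fintype.sum_option]
  cases x with
  | none => cases y <;> simp [eigvec, eigval]
  | some w =>
    cases y with
    | none => simp [eigvec]
    | some v =>
      by_cases hv : v = b
      · subst hv
        simp [eigvec, eigval]
      · simp [eigvec, eigval, hv]

theorem submatrix_mul_of_vanish {R α : Type*} [CommRing R] [Fintype α] (p q r : α → Prop)
    [DecidablePred p] (A B : Matrix α α R) (h : ∀ x y z, q x → ¬ p y → r z → A x y * B y z = 0) :
    (A * B).submatrix (Subtype.val : {x // q x} → α) (Subtype.val : {x // r x} → α) =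
      A.submatrix (Subtype.val : {x // q x} → α) (Subtype.val : {x // p x} → α) *
        B.submatrix (Subtype.val : {x // p x} → α) (Subtype.val : {x // r x} → α) := by
  ext x y
  simp only [submatrix_apply, Matrix.mul_apply]
  rw [← Finset.sum_subtype (Finset.univ.filter p) (by simp) fun i => A x i * B i y]
  exact (Finset.sum_subset (Finset.filter_subset _ _) fun i _ hi =>
    h x i y x.2 (by simpa using hi) y.2).symm

/-- The number of nonempty components, i.e. the cardinality of the corresponding face. -/
def weight (g : ∀ i, Option (W i)) : ℕ := (Finset.univ.filter fun i => (g i).isSome).card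

theorem det_laplacian_weight (b : ∀ i, W i) (k : ℕ) :
    ((colorBd ℤ W * (colorBd ℤ W)ᵀ + (colorBd ℤ W)ᵀ * colorBd ℤ W).submatrix
      (Subtype.val : {g : ∀ i, Option (W i) // weight g = k} → _) Subtype.val).det =
    ∏ g : {g : ∀ i, Option (W i) // weight g = k}, ∑ i, (eigval (b i) (g.1 i) : ℤ) := by
  set P : Matrix (∀ i, Option (W i)) (∀ i, Option (W i)) ℚ := piKron fun i => eigvec (b i)
  set Q : Matrix (∀ i, Option (W i)) (∀ i, Option (W i)) ℚ := piKron fun i => eigvecInv (b i)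
  have hQP : Q * P = 1 := by
    rw [piKron_mul, ← piKron_one]
    congr 1
    ext1 i
    exact eigvecInv_mul _
  have hKP : (colorBd ℚ W * (colorBd ℚ W)ᵀ + (colorBd ℚ W)ᵀ * colorBd ℚ W) * P =
      P * diagonal fun g => ∑ i, (eigval (b i) (g i) : ℚ) := by
    have hd : diagonal (fun g : ∀ i, Option (W i) => ∑ i, (eigval (b i) (g i) : ℚ)) =
        ∑ i, piLift i (diagonal fun x => (eigval (b i) x : ℚ)) := by
      simp only [piLift_diagonal]
      ext g g'
      rw [Matrix.sum_apply, diagonal_apply]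
      split_ifs with h <;> simp [h]
    rw [colorBd_laplacian, hd, Finset.sum_mul, Finset.mul_sum]
    refine Finset.sum_congr rfl fun i _ => ?_
    rw [piLift_mul_piKron, piKron_mul_piLift, laplacian_mul_eigvec]
  have hvanish : ∀ g g' : ∀ i, Option (W i), ¬ weight g = k → weight g' = k → P g g' = 0 := by
    intro g g' hg hg'
    by_contra hne
    change ¬ ∏ i, eigvec (b i) (g i) (g' i) = 0 at hne
    apply hg
    rw [← hg', weight, weight]
    congr 1
    ext i
    have := Finset.prod_ne_zero_iff.1 hne i (Finset.mem_univ i)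
    cases h1 : g i <;> cases h2 : g' i <;> simp_all [eigvec]
  have hdet : (P.submatrix (Subtype.val : {g : ∀ i, Option (W i) // weight g = k} → _)
      Subtype.val).det ≠ 0 := by
    have := submatrix_mul_of_vanish (weight · = k) (weight · = k) (weight · = k) Q P
      fun g g' g'' _ h h' => by rw [hvanish g' g'' h h', mul_zero]
    rw [hQP, submatrix_one _ Subtype.val_injective] at this
    intro h0
    have := congrArg Matrix.det this
    rw [det_one, det_mul, h0, mul_zero] at this
    exact one_ne_zero this
  have h1 := submatrix_mul_of_vanish (weight · = k) (weight · = k) (weight · = k)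
    (colorBd ℚ W * (colorBd ℚ W)ᵀ + (colorBd ℚ W)ᵀ * colorBd ℚ W) P
    fun g g' g'' _ h h' => by rw [hvanish g' g'' h h', mul_zero]
  rw [hKP, submatrix_mul_of_vanish (weight · = k) _ _ _ _ (fun g g' g'' _ h h' => by
    rw [diagonal_apply_ne, mul_zero]
    rintro rfl
    exact h h'), submatrix_diagonal _ _ Subtype.val_injective] at h1
  have h2 := congrArg Matrix.det h1
  rw [det_mul, det_mul, mul_comm] at h2
  have h3 := mul_right_cancel₀ hdet h2
  rw [det_diagonal] at h3
  have hcast : colorBd ℚ W = (colorBd ℤ W).map (Int.castRingHom ℚ) := by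
    ext g g'
    rw [map_apply, colorBd, colorBd, Matrix.sum_apply, Matrix.sum_apply, map_sum]
    refine Finset.sum_congr rfl fun i _ => ?_
    simp only [twist, piKron, of_apply, map_prod]
    refine Finset.prod_congr rfl fun j _ => ?_
    by_cases hji : j = i
    · subst hji
      rw [Function.update_self, Function.update_self]
      simp only [aug, of_apply]
      split_ifs <;> simp
    · rw [Function.update_of_ne hji, Function.update_of_ne hji]
      split_ifs
      · simp only [parity, diagonal_apply]
        split_ifs <;> simp
      · simp only [one_apply]
        split_ifs <;> simp
  have h4 : (colorBd ℚ W * (colorBd ℚ W)ᵀ + (colorBd ℚ W)ᵀ * colorBd ℚ W) =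
      (colorBd ℤ W * (colorBd ℤ W)ᵀ + (colorBd ℤ W)ᵀ * colorBd ℤ W).map (Int.castRingHom ℚ) := by
    rw [Matrix.map_add _ (map_add _), Matrix.map_mul, Matrix.map_mul, hcast, transpose_map]
  rw [h4, submatrix_map, ← RingHom.mapMatrix_apply, ← RingHom.map_det] at h3
  apply (Int.cast_injective : Function.Injective (Int.cast : ℤ → ℚ))
  refine h3.symm.trans ?_
  push_cast
  rfl

end Spectrum

section Transport

theorem twist_aug_apply {W : Fin n → Type*} [∀ i, Fintype (W i)] [∀ i, DecidableEq (W i)]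
    (i : Fin n) (g g' : ∀ i, Option (W i)) :
    twist i (aug ℤ (W i)) g g' = if (g' i).isSome ∧ g = Function.update g' i none then
      ∏ j, (if j < i ∧ (g' j).isSome then (-1 : ℤ) else 1) else 0 := by
  rw [twist, piKron, of_apply]
  split_ifs with h
  · obtain ⟨h1, rfl⟩ := h
    refine Finset.prod_congr rfl fun j _ => ?_
    by_cases hj : j = i
    · subst hj
      simp [aug, h1]
    · rw [Function.update_of_ne hj, Function.update_of_ne hj]
      by_cases hji : j < i <;> simp [hji, parity]
  · by_contra hne
    rw [← ne_eq, Finset.prod_ne_zero_iff] at hne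
    have hi : (g i).isSome = false ∧ (g' i).isSome := by
      simpa [aug, Option.isSome_iff_ne_none] using hne i (Finset.mem_univ i)
    refine h ⟨hi.2, funext fun j => ?_⟩
    by_cases hj : j = i
    · subst hj
      simpa using hi.1
    · have := hne j (Finset.mem_univ j)
      rw [Function.update_of_ne hj] at this ⊢
      by_contra hgg
      apply this
      by_cases hji : j < i <;> simp [hji, parity, hgg]

theorem colorBd_apply_update {W : Fin n → Type*} [∀ i, Fintype (W i)] [∀ i, DecidableEq (W i)]
    {i : Fin n} {g' : ∀ i, Option (W i)} (hi : (g' i).isSome) :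
    colorBd ℤ W (Function.update g' i none) g' =
      ∏ j, (if j < i ∧ (g' j).isSome then (-1 : ℤ) else 1) := by
  rw [colorBd, Matrix.sum_apply, Finset.sum_eq_single i, twist_aug_apply, if_pos ⟨hi, rfl⟩]
  · intro j _ hj
    rw [twist_aug_apply, if_neg]
    rintro ⟨_, h⟩
    have := congrFun h i
    rw [Function.update_self, Function.update_of_ne hj.symm] at this
    simp [← this] at hi
  · simp

theorem exists_update_of_colorBd_ne_zero {W : Fin n → Type*} [∀ i, Fintype (W i)]
    [∀ i, DecidableEq (W i)] {g g' : ∀ i, Option (W i)} (h : colorBd ℤ W g g' ≠ 0) :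
    ∃ i, (g' i).isSome ∧ g = Function.update g' i none := by
  rw [colorBd, Matrix.sum_apply] at h
  obtain ⟨i, _, hi⟩ := Finset.exists_ne_zero_of_sum_ne_zero h
  rw [twist_aug_apply] at hi
  exact ⟨i, by_contra fun hc => hi (if_neg hc)⟩

theorem weight_eq_of_colorBd_ne_zero {W : Fin n → Type*} [∀ i, Fintype (W i)]
    [∀ i, DecidableEq (W i)] {g g' : ∀ i, Option (W i)} (h : colorBd ℤ W g g' ≠ 0) :
    weight g' = weight g + 1 := by
  obtain ⟨i, hi, rfl⟩ := exists_update_of_colorBd_ne_zero h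
  have : (Finset.univ.filter fun j => (Function.update g' i none j).isSome) =
      (Finset.univ.filter fun j => (g' j).isSome).erase i := by
    ext j
    by_cases hj : j = i
    · subst hj; simp
    · simp [hj]
  rw [weight, weight, this, Finset.card_erase_add_one (by simpa using hi)]

/-- The face whose vertices are the nonempty components of `g`. -/
def support (col : V → Fin n) (g : ∀ i, Option {v // col v = i}) : Finset V :=
  Finset.univ.filter fun v => g (col v) = some ⟨v, rfl⟩

variable {col : V → Fin n}

theorem mem_support {g : ∀ i, Option {v // col v = i}} {i : Fin n} (v : {v // col v = i}) :
    v.1 ∈ support col g ↔ g i = some v := by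
  obtain ⟨v, rfl⟩ := v
  simp [support]

theorem colorful_support (g : ∀ i, Option {v // col v = i}) : Colorful col (support col g) := by
  intro v hv w hw h
  have h1 := (mem_support (g := g) ⟨v, h⟩).1 hv
  have h2 := (mem_support (g := g) ⟨w, rfl⟩).1 hw
  rw [h1] at h2
  simpa using h2

theorem card_support (g : ∀ i, Option {v // col v = i}) : (support col g).card = weight g := by
  refine Finset.card_bij (fun v _ => col v) (fun v hv => ?_)
    (fun v hv w hw h => colorful_support g v hv w hw h) fun i hi => ?_
  · simp [(mem_support (g := g) ⟨v, rfl⟩).1 hv]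
  · obtain ⟨v, hv⟩ := Option.isSome_iff_exists.1 (Finset.mem_filter.1 hi).2
    exact ⟨v.1, (mem_support v).2 hv, v.2⟩

theorem support_injective : Function.Injective (support col) := by
  intro g g' h
  ext1 i
  ext v
  rw [← mem_support, h, mem_support]

theorem exists_support_eq {σ : Finset V} (hσ : Colorful col σ) : ∃ g, support col g = σ := by
  classical
  refine ⟨fun i => if h : ∃ v : {v // col v = i}, v.1 ∈ σ then some h.choose else none, ?_⟩
  ext v
  rw [mem_support (i := col v) ⟨v, rfl⟩]
  split_ifs with h
  · have h1 := h.choose_spec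
    rw [Option.some_inj]
    constructor
    · intro h2
      rwa [h2] at h1
    · intro hv
      exact Subtype.ext (hσ _ h1 _ hv h.choose.2)
  · simp only [false_iff]
    exact fun hv => h ⟨⟨v, rfl⟩, hv⟩

theorem support_update {g : ∀ i, Option {v // col v = i}} {i : Fin n} {v : {v // col v = i}}
    (h : g i = some v) : support col (Function.update g i none) = (support col g).erase v := by
  ext w
  rw [Finset.mem_erase, mem_support (i := col w) ⟨w, rfl⟩, mem_support (i := col w) ⟨w, rfl⟩]
  by_cases hw : col w = i
  · subst hw
    simp only [Function.update_self, h, reduceCtorEq, false_iff, Option.some_inj]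
    rintro ⟨h1, rfl⟩
    exact h1 rfl
  · rw [Function.update_of_ne hw]
    simp only [iff_and_self]
    rintro - rfl
    exact hw v.2

/-- Functions with `k` nonempty components are the faces of cardinality `k`. -/
noncomputable def faceEquiv (col : V → Fin n) (k : ℕ) :
    {g : ∀ i, Option {v // col v = i} // weight g = k} ≃ ColFace col k :=
  Equiv.ofBijective (fun g => ⟨support col g.1, colorful_support _, (card_support _).trans g.2⟩)
    ⟨fun g g' h => Subtype.ext (support_injective (congrArg Subtype.val h)), fun σ => by
      obtain ⟨g, hg⟩ := exists_support_eq σ.2.1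
      exact ⟨⟨g, by rw [← card_support, hg, σ.2.2]⟩, Subtype.ext hg⟩⟩

theorem coe_faceEquiv (k : ℕ) (g : {g : ∀ i, Option {v // col v = i} // weight g = k}) :
    (faceEquiv col k g).1 = support col g.1 := rfl

/-- The sign comparing the vertex order with the color order on a face. -/
def shuffleSign (col : V → Fin n) (σ : Finset V) : ℤ :=
  ∏ x ∈ σ, ∏ y ∈ σ, if x < y ∧ col y < col x then -1 else 1

theorem shuffleSign_mul_self {X : Type*} [LinearOrder X] {c : X → Fin n} (σ : Finset X) :
    shuffleSign c σ * shuffleSign c σ = 1 := by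
  rw [shuffleSign, ← Finset.prod_mul_distrib]
  refine Finset.prod_eq_one fun x _ => ?_
  rw [← Finset.prod_mul_distrib]
  refine Finset.prod_eq_one fun y _ => ?_
  split_ifs <;> rfl

theorem shuffleSign_insert {X : Type*} [LinearOrder X] {c : X → Fin n} {τ : Finset X} {v : X}
    (hv : v ∉ τ) (hσ : Colorful c (insert v τ)) :
    shuffleSign c (insert v τ) = shuffleSign c τ *
      ((∏ y ∈ τ, if y < v then (-1 : ℤ) else 1) *
        ∏ y ∈ τ, if c y < c v then (-1 : ℤ) else 1) := by
  simp only [shuffleSign, Finset.prod_insert hv, lt_irrefl, and_self, if_false, one_mul,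
    Finset.prod_mul_distrib]
  rw [← mul_assoc, mul_comm]
  congr 1
  rw [← Finset.prod_mul_distrib, ← Finset.prod_mul_distrib]
  refine Finset.prod_congr rfl fun y hy => ?_
  have hyv : y ≠ v := fun h => hv (h ▸ hy)
  have hcol : c y ≠ c v := fun h =>
    hyv (hσ y (Finset.mem_insert_of_mem hy) v (Finset.mem_insert_self _ _) h)
  rcases lt_or_gt_of_ne hyv with h | h <;> rcases lt_or_gt_of_ne hcol with h' | h' <;>
    simp [h, h', h.not_gt, h'.not_gt]

theorem prod_support (g : ∀ i, Option {v // col v = i}) (i : Fin n) :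
    (∏ j, if j < i ∧ (g j).isSome then (-1 : ℤ) else 1) =
      ∏ y ∈ support col g, if col y < i then -1 else 1 := by
  symm
  have : ∏ j, (if j < i ∧ (g j).isSome then (-1 : ℤ) else 1) =
      ∏ j ∈ Finset.univ.filter (fun j => (g j).isSome), if j < i then -1 else 1 := by
    rw [Finset.prod_filter]
    refine Finset.prod_congr rfl fun j _ => ?_
    by_cases h : (g j).isSome <;> simp [h]
  rw [this]
  refine Finset.prod_bij (fun v _ => col v) (fun v hv => ?_)
    (fun v hv w hw h => colorful_support g v hv w hw h) (fun i hi => ?_) fun _ _ => rfl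
  · simp [(mem_support (g := g) ⟨v, rfl⟩).1 hv]
  · obtain ⟨v, hv⟩ := Option.isSome_iff_exists.1 (Finset.mem_filter.1 hi).2
    exact ⟨v.1, (mem_support v).2 hv, v.2⟩

theorem bdCol_eq_of_support {k : ℕ} {g g' : ∀ i, Option {v // col v = i}} (τ : ColFace col k)
    (σ : ColFace col (k + 1)) (hτ : τ.1 = support col g) (hσ : σ.1 = support col g') :
    bdCol col k τ σ = shuffleSign col (support col g) *
      colorBd ℤ (fun i => {v // col v = i}) g g' * shuffleSign col (support col g') := by
  have hg : (support col g).card = k := (congrArg _ hτ).symm.trans τ.2.2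
  have hg' : (support col g').card = k + 1 := (congrArg _ hσ).symm.trans σ.2.2
  obtain ⟨τ, _⟩ := τ
  obtain ⟨σ, _⟩ := σ
  dsimp only at hτ hσ
  subst hτ hσ
  simp only [bdCol, of_apply]
  by_cases h : support col g ⊆ support col g'
  · rw [if_pos h]
    have hcard : (support col g' \ support col g).card = 1 := by
      rw [Finset.card_sdiff_of_subset h, hg, hg']
      omega
    obtain ⟨v, hv⟩ := Finset.card_eq_one.1 hcard
    have hvm : v ∈ support col g' ∧ v ∉ support col g := by
      rw [← Finset.mem_sdiff, hv, Finset.mem_singleton]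
    have hgv := (mem_support (g := g') ⟨v, rfl⟩).1 hvm.1
    have hins : support col g' = insert v (support col g) := by
      rw [← Finset.sdiff_union_of_subset h, hv, Finset.singleton_union]
    have hgg : g = Function.update g' (col v) none := by
      apply support_injective
      rw [support_update hgv, hins, Finset.erase_insert hvm.2]
    have hc : colorBd ℤ (fun i => {v // col v = i}) g g' =
        ∏ y ∈ support col g, if col y < col v then -1 else 1 := by
      rw [hgg, colorBd_apply_update (by simp [hgv]), ← hgg, prod_support, hins,
        Finset.prod_insert hvm.2]
      simp
    have hp : (-1 : ℤ) ^ ((support col g').filter (fun w => w < v)).card =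
        ∏ y ∈ support col g, if y < v then -1 else 1 := by
      rw [← Finset.prod_const, Finset.prod_filter, hins, Finset.prod_insert hvm.2]
      simp
    rw [hv, Finset.sum_singleton, hp, hc, hins,
      shuffleSign_insert hvm.2 (hins ▸ colorful_support g')]
    set s := shuffleSign col (support col g) with hs
    have h1 : s * s = 1 := shuffleSign_mul_self _
    have h2 : (∏ y ∈ support col g, if col y < col v then (-1 : ℤ) else 1) *
        (∏ y ∈ support col g, if col y < col v then (-1 : ℤ) else 1) = 1 := by
      rw [← Finset.prod_mul_distrib]
      exact Finset.prod_eq_one fun y _ => by split_ifs <;> rfl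
    generalize (∏ y ∈ support col g, if col y < col v then (-1 : ℤ) else 1) = c at *
    generalize (∏ y ∈ support col g, if y < v then (-1 : ℤ) else 1) = d at *
    linear_combination (-d) * h1 - d * s * s * h2
  · rw [if_neg h]
    have : colorBd ℤ (fun i => {v // col v = i}) g g' = 0 := by
      by_contra hne
      obtain ⟨i, hi, rfl⟩ := exists_update_of_colorBd_ne_zero hne
      obtain ⟨v, hv⟩ := Option.isSome_iff_exists.1 hi
      rw [support_update hv] at h
      exact h (Finset.erase_subset _ _)
    rw [this, mul_zero, zero_mul]

theorem bdCol_faceEquiv (k : ℕ) (g : {g : ∀ i, Option {v // col v = i} // weight g = k})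
    (g' : {g : ∀ i, Option {v // col v = i} // weight g = k + 1}) :
    bdCol col k (faceEquiv col k g) (faceEquiv col (k + 1) g') =
      shuffleSign col (support col g.1) * colorBd ℤ (fun i => {v // col v = i}) g.1 g'.1 *
        shuffleSign col (support col g'.1) :=
  bdCol_eq_of_support _ _ (coe_faceEquiv k g) (coe_faceEquiv (k + 1) g')

end Transport

section Consequences

variable (col : V → Fin n)

/-- The part of `colorBd` from faces of cardinality `l` to faces of cardinality `k`. -/
def colorBlock (k l : ℕ) : Matrix {g : ∀ i, Option {v // col v = i} // weight g = k}
    {g : ∀ i, Option {v // col v = i} // weight g = l} ℤ :=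
  (colorBd ℤ fun i => {v // col v = i}).submatrix Subtype.val Subtype.val

/-- The diagonal matrix of the signs `shuffleSign`. -/
def signDiag (k : ℕ) : Matrix {g : ∀ i, Option {v // col v = i} // weight g = k}
    {g : ∀ i, Option {v // col v = i} // weight g = k} ℤ :=
  diagonal fun g => shuffleSign col (support col g.1)

theorem signDiag_mul_self (k : ℕ) : signDiag col k * signDiag col k = 1 := by
  rw [signDiag, diagonal_mul_diagonal, ← diagonal_one]
  congr 1
  exact funext fun g => shuffleSign_mul_self _

theorem signDiag_transpose (k : ℕ) : (signDiag col k)ᵀ = signDiag col k := diagonal_transpose _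

theorem bdCol_submatrix (k : ℕ) :
    (bdCol col k).submatrix (faceEquiv col k) (faceEquiv col (k + 1)) =
      signDiag col k * colorBlock col k (k + 1) * signDiag col (k + 1) := by
  ext g g'
  rw [signDiag, signDiag, mul_diagonal, diagonal_mul]
  exact bdCol_faceEquiv k g g'

theorem colorBlock_mul (k : ℕ) : colorBlock col k (k + 1) * colorBlock col (k + 1) (k + 2) = 0 := by
  have h := submatrix_mul_of_vanish (weight · = k + 1) (weight · = k) (weight · = k + 2)
    (colorBd ℤ fun i => {v // col v = i}) (colorBd ℤ fun i => {v // col v = i})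
    fun g g' g'' h h' h'' => by
      by_contra hne
      exact h' (by rw [weight_eq_of_colorBd_ne_zero (left_ne_zero_of_mul hne), h])
  rw [colorBd_mul_self] at h
  exact h.symm

theorem bdCol_mul_bdCol (k : ℕ) : bdCol col k * bdCol col (k + 1) = 0 := by
  have h : (bdCol col k * bdCol col (k + 1)).submatrix (faceEquiv col k) (faceEquiv col (k + 2)) =
      0 := by
    rw [← submatrix_mul_equiv _ _ _ (faceEquiv col (k + 1)), bdCol_submatrix, bdCol_submatrix]
    calc _ = signDiag col k * (colorBlock col k (k + 1) *
          (signDiag col (k + 1) * signDiag col (k + 1)) * colorBlock col (k + 1) (k + 2)) *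
            signDiag col (k + 2) := by simp only [Matrix.mul_assoc]
      _ = 0 := by rw [signDiag_mul_self, Matrix.mul_one, colorBlock_mul, Matrix.mul_zero,
            Matrix.zero_mul]
  ext τ σ
  have := congrFun (congrFun h ((faceEquiv col k).symm τ)) ((faceEquiv col (k + 2)).symm σ)
  simpa using this

theorem det_of_submatrix_eq {k : ℕ} {M : Matrix (ColFace col k) (ColFace col k) ℤ}
    {N : Matrix {g : ∀ i, Option {v // col v = i} // weight g = k}
      {g : ∀ i, Option {v // col v = i} // weight g = k} ℤ}
    (h : M.submatrix (faceEquiv col k) (faceEquiv col k) = signDiag col k * N * signDiag col k) :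
    M.det = N.det := by
  rw [← det_submatrix_equiv_self (faceEquiv col k), h, det_mul, det_mul, mul_right_comm, ← det_mul,
    signDiag_mul_self, det_one, one_mul]

theorem bdCol_mul_transpose_submatrix (k : ℕ) :
    (bdCol col k * (bdCol col k)ᵀ).submatrix (faceEquiv col k) (faceEquiv col k) =
      signDiag col k * (colorBlock col k (k + 1) * (colorBlock col k (k + 1))ᵀ) *
        signDiag col k := by
  rw [← submatrix_mul_equiv _ _ _ (faceEquiv col (k + 1)), ← transpose_submatrix, bdCol_submatrix,
    transpose_mul, transpose_mul, signDiag_transpose, signDiag_transpose]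
  calc _ = signDiag col k * (colorBlock col k (k + 1) *
        (signDiag col (k + 1) * signDiag col (k + 1)) * (colorBlock col k (k + 1))ᵀ) *
          signDiag col k := by simp only [Matrix.mul_assoc]
    _ = _ := by rw [signDiag_mul_self, Matrix.mul_one]

theorem transpose_mul_bdCol_submatrix (k : ℕ) :
    ((bdCol col k)ᵀ * bdCol col k).submatrix (faceEquiv col (k + 1)) (faceEquiv col (k + 1)) =
      signDiag col (k + 1) * ((colorBlock col k (k + 1))ᵀ * colorBlock col k (k + 1)) *
        signDiag col (k + 1) := by
  rw [← submatrix_mul_equiv _ _ _ (faceEquiv col k), ← transpose_submatrix, bdCol_submatrix,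
    transpose_mul, transpose_mul, signDiag_transpose, signDiag_transpose]
  calc _ = signDiag col (k + 1) * ((colorBlock col k (k + 1))ᵀ *
        (signDiag col k * signDiag col k) * colorBlock col k (k + 1)) *
          signDiag col (k + 1) := by simp only [Matrix.mul_assoc]
    _ = _ := by rw [signDiag_mul_self, Matrix.mul_one]

theorem colorBd_mul_transpose_block (k : ℕ) :
    ((colorBd ℤ fun i => {v // col v = i}) * (colorBd ℤ fun i => {v // col v = i})ᵀ).submatrix
      (Subtype.val : {g : ∀ i, Option {v // col v = i} // weight g = k} → _) Subtype.val =
    colorBlock col k (k + 1) * (colorBlock col k (k + 1))ᵀ :=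
  submatrix_mul_of_vanish (weight · = k + 1) (weight · = k) (weight · = k) _ _
    fun g g' g'' h h' h'' => by
      by_contra hne
      exact h' (by rw [weight_eq_of_colorBd_ne_zero (left_ne_zero_of_mul hne), h])

theorem colorBd_transpose_mul_block (k : ℕ) :
    ((colorBd ℤ fun i => {v // col v = i})ᵀ * (colorBd ℤ fun i => {v // col v = i})).submatrix
      (Subtype.val : {g : ∀ i, Option {v // col v = i} // weight g = k + 1} → _) Subtype.val =
    (colorBlock col k (k + 1))ᵀ * colorBlock col k (k + 1) :=
  submatrix_mul_of_vanish (weight · = k) (weight · = k + 1) (weight · = k + 1) _ _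
    fun g g' g'' h h' h'' => by
      by_contra hne
      have := weight_eq_of_colorBd_ne_zero (right_ne_zero_of_mul hne)
      omega

theorem det_laplacian_succ (b : ∀ i, {v // col v = i}) (k : ℕ) :
    (bdCol col (k + 1) * (bdCol col (k + 1))ᵀ + (bdCol col k)ᵀ * bdCol col k).det =
      ∏ g : {g : ∀ i, Option {v // col v = i} // weight g = k + 1},
        ∑ i, (eigval (b i) (g.1 i) : ℤ) := by
  rw [← det_laplacian_weight b]
  apply det_of_submatrix_eq
  rw [submatrix_add, Pi.add_apply, Pi.add_apply, submatrix_add, Pi.add_apply, Pi.add_apply,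
    bdCol_mul_transpose_submatrix, transpose_mul_bdCol_submatrix, colorBd_mul_transpose_block,
    colorBd_transpose_mul_block, Matrix.mul_add, Matrix.add_mul]

theorem det_laplacian_zero (b : ∀ i, {v // col v = i}) :
    (bdCol col 0 * (bdCol col 0)ᵀ).det =
      ∏ g : {g : ∀ i, Option {v // col v = i} // weight g = 0},
        ∑ i, (eigval (b i) (g.1 i) : ℤ) := by
  rw [← det_laplacian_weight b]
  apply det_of_submatrix_eq
  have h0 : ((colorBd ℤ fun i => {v // col v = i})ᵀ *
      (colorBd ℤ fun i => {v // col v = i})).submatrix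
      (Subtype.val : {g : ∀ i, Option {v // col v = i} // weight g = 0} → _)
      (Subtype.val : {g : ∀ i, Option {v // col v = i} // weight g = 0} → _) = 0 := by
    ext g g'
    rw [submatrix_apply, Matrix.mul_apply]
    refine Finset.sum_eq_zero fun x _ => ?_
    by_contra hne
    have := weight_eq_of_colorBd_ne_zero (right_ne_zero_of_mul hne)
    have := g'.2
    omega
  rw [submatrix_add, Pi.add_apply, Pi.add_apply, h0, add_zero, bdCol_mul_transpose_submatrix,
    colorBd_mul_transpose_block]

theorem colorBd_mulVec_apply (k : ℕ) (g : {g : ∀ i, Option {v // col v = i} // weight g = k})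
    (y : (∀ i, Option {v // col v = i}) → ℤ) :
    (colorBd ℤ (fun i => {v // col v = i}) *ᵥ y) g.1 =
      (colorBlock col k (k + 1) *ᵥ fun g' => y g'.1) g := by
  simp only [mulVec, dotProduct, colorBlock, submatrix_apply]
  rw [← Finset.sum_subtype (Finset.univ.filter (weight · = k + 1)) (by simp)
    fun g' => colorBd ℤ (fun i => {v // col v = i}) g.1 g' * y g']
  refine (Finset.sum_subset (Finset.filter_subset _ _) fun x _ hx => ?_).symm
  by_contra hne
  have := weight_eq_of_colorBd_ne_zero (left_ne_zero_of_mul hne)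
  rw [g.2] at this
  simp [this] at hx

theorem bdCol_mulVec_apply (k : ℕ) (g : {g : ∀ i, Option {v // col v = i} // weight g = k})
    (y : ColFace col (k + 1) → ℤ) :
    (bdCol col k *ᵥ y) (faceEquiv col k g) = shuffleSign col (support col g.1) *
      (colorBlock col k (k + 1) *ᵥ
        fun g' => shuffleSign col (support col g'.1) * y (faceEquiv col (k + 1) g')) g := by
  simp only [mulVec, dotProduct, Finset.mul_sum]
  rw [← Equiv.sum_comp (faceEquiv col (k + 1))]
  refine Finset.sum_congr rfl fun g' _ => ?_
  rw [bdCol_faceEquiv, colorBlock, submatrix_apply]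
  ring

theorem exists_bdCol_mulVec_eq (b : ∀ i, {v // col v = i}) {k : ℕ} (hk : k < n)
    (z : ColFace col k → ℤ) (hz : z ∈ ZcC col k) : ∃ y, bdCol col k *ᵥ y = z := by
  set z' : (∀ i, Option {v // col v = i}) → ℤ := fun g =>
    if h : weight g = k then shuffleSign col (support col g) * z (faceEquiv col k ⟨g, h⟩) else 0
    with hz'
  have hC : colorBd ℤ (fun i => {v // col v = i}) *ᵥ z' = 0 := by
    ext g
    by_cases hg : weight g + 1 = k
    · subst hg
      rw [colorBd_mulVec_apply col _ ⟨g, rfl⟩]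
      have h1 : bdCol col (weight g) *ᵥ z = 0 := hz
      have h2 := bdCol_mulVec_apply col (weight g) ⟨g, rfl⟩ z
      rw [h1, Pi.zero_apply, eq_comm] at h2
      have h3 := (mul_eq_zero.1 h2).resolve_left
        (left_ne_zero_of_mul_eq_one (shuffleSign_mul_self _))
      rw [Pi.zero_apply, ← h3]
      congr 2
      ext g'
      simp only [hz', g'.2, dif_pos]
    · refine Finset.sum_eq_zero fun g' _ => ?_
      by_contra hne
      have h1 := weight_eq_of_colorBd_ne_zero (left_ne_zero_of_mul hne)
      rw [hz'] at hne
      simp only [dif_neg (show ¬ weight g' = k by omega), mul_zero, not_true] at hne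
  obtain ⟨y, hy⟩ := exists_colorBd_eq b z' hC fun g hg => by
    have : weight g = n := by
      rw [weight, Finset.filter_true_of_mem fun i _ => Option.isSome_iff_ne_none.2 (hg i)]
      simp
    exact dif_neg (by omega)
  refine ⟨fun σ => shuffleSign col σ.1 * y ((faceEquiv col (k + 1)).symm σ).1, ?_⟩
  ext τ
  obtain ⟨g, rfl⟩ := (faceEquiv col k).surjective τ
  rw [bdCol_mulVec_apply]
  have : (fun g' : {g : ∀ i, Option {v // col v = i} // weight g = k + 1} =>
      shuffleSign col (support col g'.1) * (shuffleSign col (faceEquiv col (k + 1) g').1 *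
        y ((faceEquiv col (k + 1)).symm (faceEquiv col (k + 1) g')).1)) = fun g' => y g'.1 := by
    ext g'
    rw [Equiv.symm_apply_apply, coe_faceEquiv, ← mul_assoc, shuffleSign_mul_self, one_mul]
  rw [this, ← colorBd_mulVec_apply, hy, hz']
  simp only [g.2, dif_pos]
  rw [← mul_assoc, shuffleSign_mul_self, one_mul]

end Consequences

section Counting

variable {W : Fin n → Type*} [∀ i, Fintype (W i)] [∀ i, DecidableEq (W i)]

/-- The indices at which `g` is a vertex other than the base point. -/
def generic (b : ∀ i, W i) (g : ∀ i, Option (W i)) : Finset (Fin n) :=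
  Finset.univ.filter fun i => ¬ (g i = none ∨ g i = some (b i))

theorem sum_eigval (b : ∀ i, W i) (g : ∀ i, Option (W i)) :
    ∑ i, eigval (b i) (g i) = ∑ i ∈ (generic b g)ᶜ, Fintype.card (W i) := by
  simp only [eigval, generic, Finset.compl_filter, not_not, Finset.sum_filter]

open Polynomial in
theorem sum_X_pow_weight (b : ∀ i, W i) (J : Finset (Fin n)) :
    ∑ g ∈ Finset.univ.filter (fun g => generic b g = J), (X : ℕ[X]) ^ weight g =
      C (∏ l ∈ J, (Fintype.card (W l) - 1)) * ((1 + X) ^ (n - J.card) * X ^ J.card) := by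
  set f : ∀ i, Option (W i) → ℕ[X] := fun i x =>
    if ¬ (x = none ∨ x = some (b i)) ↔ i ∈ J then (if x.isSome then X else 1) else 0 with hf
  have h1 : ∑ g ∈ Finset.univ.filter (fun g => generic b g = J), (X : ℕ[X]) ^ weight g =
      ∑ g : ∀ i, Option (W i), ∏ i, f i (g i) := by
    rw [Finset.sum_filter]
    refine Finset.sum_congr rfl fun g _ => ?_
    rw [hf, Finset.prod_ite_zero]
    simp only [generic, Finset.ext_iff, Finset.mem_filter, Finset.mem_univ, true_and,
      true_implies]
    congr 1
    rw [weight, ← Finset.prod_const, Finset.prod_filter]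
  have h2 : ∀ i, ∑ x, f i x = if i ∈ J then C (Fintype.card (W i) - 1) * X else 1 + X := by
    intro i
    rw [Fintype.sum_option]
    by_cases hi : i ∈ J
    · simp [hf, hi, Finset.sum_ite, Finset.filter_ne', Finset.card_erase_of_mem]
    · simp [hf, hi]
  rw [h1, ← Fintype.piFinset_univ, ← Finset.prod_univ_sum]
  simp only [h2]
  rw [Finset.prod_ite, Finset.prod_mul_distrib, Finset.prod_const, Finset.prod_const, map_prod,
    Finset.filter_not, Finset.card_sdiff_of_subset (Finset.filter_subset _ _)]
  simp only [Finset.filter_mem_eq_inter, Finset.univ_inter, Finset.card_univ, Fintype.card_fin]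
  ring

open Polynomial in
theorem card_generic_eq (b : ∀ i, W i) (J : Finset (Fin n)) (k : ℕ) :
    (Finset.univ.filter fun g => weight g = k ∧ generic b g = J).card =
      (∏ l ∈ J, (Fintype.card (W l) - 1)) *
        if J.card ≤ k then (n - J.card).choose (k - J.card) else 0 := by
  have h := congrArg (coeff · k) (sum_X_pow_weight b J)
  simp only [finsetSum_coeff, coeff_X_pow, coeff_C_mul, coeff_mul_X_pow', coeff_one_add_X_pow,
    Nat.cast_id] at h
  rw [← h, Finset.card_filter, Finset.sum_filter]
  refine Finset.sum_congr rfl fun g _ => ?_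
  have h1 : weight g = k ↔ k = weight g := eq_comm
  by_cases h2 : generic b g = J <;> simp [h1, h2]

theorem prod_sum_eigval (b : ∀ i, W i) (k : ℕ) :
    ∏ g : {g : ∀ i, Option (W i) // weight g = k}, ∑ i, eigval (b i) (g.1 i) =
      ∏ J : Finset (Fin n), (∑ i ∈ Jᶜ, Fintype.card (W i)) ^
        ((∏ l ∈ J, (Fintype.card (W l) - 1)) *
          if J.card ≤ k then (n - J.card).choose (k - J.card) else 0) := by
  rw [← Finset.prod_subtype (Finset.univ.filter (weight · = k)) (by simp)
    fun g => ∑ i, eigval (b i) (g i)]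
  simp only [sum_eigval]
  rw [← Finset.prod_fiberwise _ (generic b)]
  refine Finset.prod_congr rfl fun J _ => ?_
  rw [← card_generic_eq b J k, ← Finset.prod_const, Finset.filter_filter]
  refine Finset.prod_congr rfl fun g hg => ?_
  rw [(Finset.mem_filter.1 hg).2.2]

end Counting

section Recursion

/-- The product of the `B(J)` to the binomial exponents occurring in `τ_{k-1}`. -/
def treeProd (a : Fin n → ℕ) (k : ℕ) : ℕ :=
  ∏ J : Finset (Fin n), (∑ i ∈ Jᶜ, a i) ^
    ((∏ l ∈ J, (a l - 1)) * if J.card < k then (n - 2 - J.card).choose (k - 1 - J.card) else 0)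

theorem treeProd_zero (a : Fin n → ℕ) : treeProd a 0 = 1 := by
  simp [treeProd]

theorem treeProd_succ (a : Fin n → ℕ) (k : ℕ) : treeProd a (k + 1) =
    ∏ j ∈ Finset.range (k + 1), ∏ J ∈ Finset.univ.filter (fun J : Finset (Fin n) => J.card = j),
      ((∑ i ∈ Jᶜ, a i) ^ (∏ l ∈ J, (a l - 1))) ^ ((n - j - 2).choose (k - j)) := by
  have h : treeProd a (k + 1) = ∏ J ∈ Finset.univ.filter (fun J : Finset (Fin n) => J.card < k + 1),
      ((∑ i ∈ Jᶜ, a i) ^ (∏ l ∈ J, (a l - 1))) ^ ((n - J.card - 2).choose (k - J.card)) := by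
    rw [Finset.prod_filter]
    refine Finset.prod_congr rfl fun J _ => ?_
    split_ifs with h
    · rw [pow_mul, Nat.sub_right_comm, Nat.add_sub_cancel]
    · rw [mul_zero, pow_zero]
  rw [h, ← Finset.prod_fiberwise_of_maps_to (t := Finset.range (k + 1)) (g := Finset.card)
    fun J hJ => Finset.mem_range.2 (Finset.mem_filter.1 hJ).2]
  refine Finset.prod_congr rfl fun j hj => ?_
  rw [Finset.filter_filter]
  have hf : (Finset.univ.filter fun J : Finset (Fin n) => J.card < k + 1 ∧ J.card = j) =
      Finset.univ.filter fun J : Finset (Fin n) => J.card = j := by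
    refine Finset.filter_congr fun J _ => ⟨And.right, fun h => ⟨?_, h⟩⟩
    rw [h]
    exact Finset.mem_range.1 hj
  rw [hf]
  exact Finset.prod_congr rfl fun J hJ => by rw [(Finset.mem_filter.1 hJ).2]

theorem treeProd_pos {a : Fin n → ℕ} (ha : ∀ i, 0 < a i) {k : ℕ} (hk : k ≤ n) :
    0 < treeProd a k := by
  refine Finset.prod_pos fun J _ => ?_
  split_ifs with h
  · refine pow_pos (Finset.sum_pos (fun i _ => ha i) ?_) _
    rw [← Finset.card_pos, Finset.card_compl, Fintype.card_fin]
    omega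
  · simp

theorem choose_add_two (m r : ℕ) :
    (m + 2).choose (r + 2) = m.choose (r + 2) + 2 * m.choose (r + 1) + m.choose r := by
  rw [Nat.choose_succ_succ, Nat.choose_succ_succ m, Nat.choose_succ_succ m]
  ring

theorem treeProd_recursion (a : Fin n → ℕ) {k : ℕ} (hk : k + 3 ≤ n) :
    treeProd a (k + 2) * treeProd a (k + 1) ^ 2 * treeProd a k =
      ∏ J : Finset (Fin n), (∑ i ∈ Jᶜ, a i) ^ ((∏ l ∈ J, (a l - 1)) *
        if J.card ≤ k + 1 then (n - J.card).choose (k + 1 - J.card) else 0) := by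
  simp only [treeProd]
  rw [← Finset.prod_pow, ← Finset.prod_mul_distrib, ← Finset.prod_mul_distrib]
  refine Finset.prod_congr rfl fun J _ => ?_
  rw [← pow_mul, ← pow_add, ← pow_add, mul_assoc, ← mul_add, ← mul_add]
  congr 2
  by_cases h : J.card ≤ k + 1
  · obtain ⟨m, hm⟩ : ∃ m, n = m + 2 + J.card := ⟨n - 2 - J.card, by omega⟩
    have e1 : n - 2 - J.card = m := by omega
    have e2 : n - J.card = m + 2 := by omega
    rw [e1, e2, if_pos (by omega), if_pos h]
    rcases (show J.card = k + 1 ∨ J.card = k ∨ J.card < k by omega) with h1 | h1 | h1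
    · rw [if_neg (by omega), if_neg (by omega)]
      simp [h1]
    · rw [if_pos (by omega), if_neg (by omega)]
      simp [h1]
    · obtain ⟨r, hr⟩ : ∃ r, k = r + J.card + 1 := ⟨k - J.card - 1, by omega⟩
      rw [if_pos (by omega), if_pos h1, show k + 1 - J.card = r + 2 by omega, choose_add_two,
        show k + 2 - 1 - J.card = r + 2 by omega, show k + 1 - 1 - J.card = r + 1 by omega,
        show k - 1 - J.card = r by omega]
      ring
  · rw [if_neg (by omega), if_neg (by omega), if_neg (by omega), if_neg h]
    rfl

theorem treeProd_one (a : Fin n → ℕ) :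
    treeProd a 1 = ∏ J : Finset (Fin n), (∑ i ∈ Jᶜ, a i) ^ ((∏ l ∈ J, (a l - 1)) *
        if J.card ≤ 0 then (n - J.card).choose (0 - J.card) else 0) := by
  simp [treeProd]

theorem tauCol_eq_treeProd {a : Fin n → ℕ} (ha : ∀ i, 0 < a i) {col : V → Fin n}
    (hcol : ∀ i, (Finset.univ.filter fun v => col v = i).card = a i) {k : ℕ} (hk : k + 2 ≤ n) :
    tauCol col k = treeProd a (k + 1) ∧ cycleGram col k = treeProd a k := by
  have hcard : ∀ i, Fintype.card {v // col v = i} = a i := fun i => by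
    rw [Fintype.card_subtype, hcol]
  have hne : ∀ i, Nonempty {v // col v = i} := fun i => by
    rw [← Fintype.card_pos_iff, hcard]
    exact ha i
  let b : ∀ i, {v // col v = i} := fun i => (hne i).some
  have hprod : ∀ k, ∏ g : {g : ∀ i, Option {v // col v = i} // weight g = k},
      ∑ i, (eigval (b i) (g.1 i) : ℤ) = ∏ J : Finset (Fin n), (∑ i ∈ Jᶜ, a i) ^
        ((∏ l ∈ J, (a l - 1)) *
          if J.card ≤ k then (n - J.card).choose (k - J.card) else 0) := fun k => by
    have := prod_sum_eigval b k
    simp only [hcard] at this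
    exact_mod_cast this
  induction k with
  | zero =>
    refine ⟨?_, by rw [cycleGram_zero, treeProd_zero, Nat.cast_one]⟩
    have h := det_laplacian_zero col b
    rw [det_bdCol_zero col (bdCol_mul_bdCol col), hprod] at h
    rw [treeProd_one]
    exact_mod_cast h
  | succ k ih =>
    obtain ⟨h1, h2⟩ := ih (by omega)
    obtain ⟨h3, h4⟩ := det_laplacian_bdCol col (bdCol_mul_bdCol col) k
      (exists_bdCol_mulVec_eq col b (by omega))
    refine ⟨?_, by rw [h4, h1]⟩
    rw [det_laplacian_succ col b, hprod, h1, h2] at h3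
    have h5 := treeProd_recursion a (k := k) (by omega)
    have h6 : tauCol col (k + 1) * treeProd a (k + 1) ^ 2 * treeProd a k =
        treeProd a (k + 2) * treeProd a (k + 1) ^ 2 * treeProd a k := by
      rw [h5]
      exact_mod_cast h3.symm
    exact Nat.eq_of_mul_eq_mul_right (pow_pos (treeProd_pos ha (by omega)) 2)
      (Nat.eq_of_mul_eq_mul_right (treeProd_pos ha (by omega)) h6)

end Recursion

/-- **Adin's theorem** (spanning tree enumeration for complete colorful complexes).
Let `X` be the complete colorful complex with color classes of sizes `a 1, …, a n`
(`n ≥ 2`, all `a i ≥ 1`).  With `B(J) = (Σ_{i ∉ J} a i)^{∏_{j ∈ J} (a j - 1)}`, for every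
`0 ≤ k ≤ n - 2` we have
`τ_k(X) = ∏_{j=0}^k ∏_{J ⊆ [n], |J| = j} B(J)^{binom(n-j-2, k-j)}`. -/
theorem adin_colorful_tree_count
    (hn : 2 ≤ n) (a : Fin n → ℕ) (ha : ∀ i, 0 < a i)
    (col : V → Fin n)
    (hcol : ∀ i, (Finset.univ.filter fun v => col v = i).card = a i)
    (k : ℕ) (hk : k ≤ n - 2) :
    tauCol col k =
      ∏ j ∈ Finset.range (k + 1),
        ∏ J ∈ Finset.univ.filter (fun J : Finset (Fin n) => J.card = j),
          ((∑ i ∈ Jᶜ, a i) ^ (∏ l ∈ J, (a l - 1))) ^ ((n - j - 2).choose (k - j)) := by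
  rw [(tauCol_eq_treeProd ha hcol (by omega)).1, treeProd_succ]

end ColorfulPaper
end
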